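/- arXiv:1904.02588 — 2 statements merged into one kernel-verified Lean document; each statement's English description precedes it below -/
import Mathlib

section
/- For every n ∈ ℕ and all (t,Q) ∈ ℝ², the Gauss–Hermite wave packet satisfies the free nonrelativistic Schrödinger equation i·∂_t χ_n(t,Q) + (1/(2M))·∂²_Q χ_n(t,Q) = 0, where M = τ/(2σ²). -/
/-- Probabilists' Hermite polynomial `He_n(y) = (−1)^n·e^{y²/2}·(d/dy)^n e^{−y²/2}`. -/
noncomputable def He (n : ℕ) (y : ℝ) : ℝ :=
  (-1) ^ n * Real.exp (y ^ 2 / 2) *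
    iteratedDeriv n (fun z : ℝ => Real.exp (-(z ^ 2) / 2)) y

/-- Time-dependent variance `σ(t) = σ·√(1 + t²/τ²)` with `σ = √(τ/(2M))`. -/
noncomputable def sigmaT (M τ t : ℝ) : ℝ :=
  Real.sqrt (τ / (2 * M)) * Real.sqrt (1 + t ^ 2 / τ ^ 2)

/-- Gauss–Hermite wave packet `χ_n(t,Q)`. -/
noncomputable def chi (M τ : ℝ) (n : ℕ) (t Q : ℝ) : ℂ :=
  ((1 / Real.sqrt ((n.factorial : ℝ) * Real.sqrt (2 * Real.pi)) : ℝ) : ℂ) *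
  ((1 / Real.sqrt (sigmaT M τ t) : ℝ) : ℂ) *
  Complex.exp (-(Complex.I * (2 * (n : ℂ) + 1) * (Real.arctan (t / τ) : ℂ) / 2)) *
  Complex.exp (Complex.I * (t : ℂ) * (Q : ℂ) ^ 2 / (4 * (τ : ℂ) * (sigmaT M τ t : ℂ) ^ 2)
    - ((Q ^ 2 / (4 * (sigmaT M τ t) ^ 2) : ℝ) : ℂ)) *
  ((He n (Q / sigmaT M τ t) : ℝ) : ℂ)

open Polynomial in
theorem derivative_derivative_hermite (n : ℕ) :
    derivative (derivative (hermite n)) = X * derivative (hermite n) - (n : ℤ[X]) * hermite n := by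
  induction n with
  | zero => simp
  | succ n ih =>
    have h : derivative (hermite (n + 1)) = ((n : ℤ[X]) + 1) * hermite n := by
      rw [hermite_succ, derivative_sub, derivative_mul, derivative_X, ih]
      ring
    rw [h, derivative_mul]
    simp only [derivative_add, derivative_natCast, derivative_one, hermite_succ]
    push_cast
    ring

theorem He_eq_aeval_hermite (n : ℕ) (y : ℝ) : He n y = Polynomial.aeval y (Polynomial.hermite n) := by
  rw [Polynomial.hermite_eq_deriv_gaussian', He, iteratedDeriv_eq_iterate]
  simp only [neg_div]
  ring

theorem hasDerivAt_He (n : ℕ) (y : ℝ) :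
    HasDerivAt (He n) (Polynomial.aeval y (Polynomial.derivative (Polynomial.hermite n))) y := by
  rw [funext (He_eq_aeval_hermite n)]
  exact Polynomial.hasDerivAt_aeval _ y

theorem sigmaT_pos {M τ : ℝ} (hM : 0 < M) (hτ : 0 < τ) (t : ℝ) : 0 < sigmaT M τ t := by
  unfold sigmaT
  positivity

theorem sigmaT_sq {M τ : ℝ} (hM : 0 < M) (hτ : 0 < τ) (t : ℝ) :
    sigmaT M τ t ^ 2 = (τ ^ 2 + t ^ 2) / (2 * M * τ) := by
  rw [sigmaT, mul_pow, Real.sq_sqrt (by positivity), Real.sq_sqrt (by positivity)]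
  field_simp

theorem hasDerivAt_sigmaT {M τ : ℝ} (hM : 0 < M) (hτ : 0 < τ) (t : ℝ) :
    HasDerivAt (sigmaT M τ) (sigmaT M τ t * (t / (τ ^ 2 + t ^ 2))) t := by
  have h1 : HasDerivAt (fun s : ℝ => 1 + s ^ 2 / τ ^ 2) (2 * t / τ ^ 2) t := by
    simpa using ((hasDerivAt_pow 2 t).div_const (τ ^ 2)).const_add 1
  have h0 : 0 < 1 + t ^ 2 / τ ^ 2 := by positivity
  refine ((h1.sqrt h0.ne').const_mul (Real.sqrt (τ / (2 * M)))).congr_deriv ?_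
  have h2 : Real.sqrt (1 + t ^ 2 / τ ^ 2) ^ 2 = (τ ^ 2 + t ^ 2) / τ ^ 2 := by
    rw [Real.sq_sqrt h0.le]
    field_simp
  have h3 : t / (τ ^ 2 + t ^ 2) = t / τ ^ 2 / Real.sqrt (1 + t ^ 2 / τ ^ 2) ^ 2 := by
    rw [h2]
    field_simp
  have h4 := (Real.sqrt_pos.2 h0).ne'
  rw [sigmaT, h3]
  field_simp

theorem hasDerivAt_one_div_sqrt_sigmaT {M τ : ℝ} (hM : 0 < M) (hτ : 0 < τ) (t : ℝ) :
    HasDerivAt (fun s => 1 / Real.sqrt (sigmaT M τ s))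
      (1 / Real.sqrt (sigmaT M τ t) * (-(t / (τ ^ 2 + t ^ 2)) / 2)) t := by
  have h0 := sigmaT_pos hM hτ t
  have h1 := (Real.sqrt_pos.2 h0).ne'
  have h := ((hasDerivAt_sigmaT hM hτ t).sqrt h0.ne').inv h1
  simp only [one_div]
  refine h.congr_deriv ?_
  have h2 := Real.sq_sqrt h0.le
  rw [h2]
  field_simp

theorem hasDerivAt_arctan_div {τ : ℝ} (hτ : 0 < τ) (t : ℝ) :
    HasDerivAt (fun s => Real.arctan (s / τ)) (τ / (τ ^ 2 + t ^ 2)) t := by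
  refine ((hasDerivAt_id t).div_const τ).arctan.congr_deriv ?_
  simp only [id]
  field_simp

theorem ofReal_add_I_mul_ne_zero {τ : ℝ} (hτ : 0 < τ) (t : ℝ) : (τ : ℂ) + Complex.I * t ≠ 0 := by
  intro h
  have := congrArg Complex.re h
  simp at this
  exact hτ.ne' this

theorem ofReal_sub_I_mul_ne_zero {τ : ℝ} (hτ : 0 < τ) (t : ℝ) : (τ : ℂ) - Complex.I * t ≠ 0 := by
  intro h
  have := congrArg Complex.re h
  simp at this
  exact hτ.ne' this

theorem sq_add_sq_eq_mul_conj (τ t : ℝ) :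
    (τ : ℂ) ^ 2 + (t : ℂ) ^ 2 = (τ + Complex.I * t) * (τ - Complex.I * t) := by
  linear_combination (t : ℂ) ^ 2 * Complex.I_sq

theorem ofReal_sigmaT_sq {M τ : ℝ} (hM : 0 < M) (hτ : 0 < τ) (t : ℝ) :
    (sigmaT M τ t : ℂ) ^ 2 = (τ + Complex.I * t) * (τ - Complex.I * t) / (2 * M * τ) := by
  rw [← sq_add_sq_eq_mul_conj]
  exact_mod_cast congrArg Complex.ofReal (sigmaT_sq hM hτ t)

theorem gaussian_exponent_eq {M τ : ℝ} (hM : 0 < M) (hτ : 0 < τ) (t Q : ℝ) :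
    Complex.I * (t : ℂ) * (Q : ℂ) ^ 2 / (4 * (τ : ℂ) * (sigmaT M τ t : ℂ) ^ 2)
      - ((Q ^ 2 / (4 * (sigmaT M τ t) ^ 2) : ℝ) : ℂ)
      = -(M * (Q : ℂ) ^ 2 / 2) / (τ + Complex.I * t) := by
  have hM' : (M : ℂ) ≠ 0 := by exact_mod_cast hM.ne'
  have hτ' : (τ : ℂ) ≠ 0 := by exact_mod_cast hτ.ne'
  have h1 := ofReal_add_I_mul_ne_zero hτ t
  have h2 := ofReal_sub_I_mul_ne_zero hτ t
  push_cast
  rw [ofReal_sigmaT_sq hM hτ]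
  field_simp
  ring

theorem hasDerivAt_chi_time {M τ : ℝ} (hM : 0 < M) (hτ : 0 < τ) (n : ℕ) (t Q : ℝ) :
    HasDerivAt (fun s => chi M τ n s Q)
      (((1 / Real.sqrt ((n.factorial : ℝ) * Real.sqrt (2 * Real.pi)) : ℝ) : ℂ) *
        ((1 / Real.sqrt (sigmaT M τ t) : ℝ) : ℂ) *
        Complex.exp (-(Complex.I * (2 * (n : ℂ) + 1) * (Real.arctan (t / τ) : ℂ) / 2)) *
        Complex.exp (-(M * (Q : ℂ) ^ 2 / 2) / (τ + Complex.I * t)) *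
        ((-((t : ℂ) / (τ ^ 2 + t ^ 2)) / 2
            - Complex.I * (2 * n + 1) * (τ / (τ ^ 2 + t ^ 2)) / 2
            + Complex.I * M * Q ^ 2 / (2 * (τ + Complex.I * t) ^ 2)) * (He n (Q / sigmaT M τ t) : ℂ)
          - Q / sigmaT M τ t * (t / (τ ^ 2 + t ^ 2)) *
            (Polynomial.aeval (Q / sigmaT M τ t)
              (Polynomial.derivative (Polynomial.hermite n)) : ℝ))) t := by
  have hs := (sigmaT_pos hM hτ t).ne'
  have hs' : (sigmaT M τ t : ℂ) ≠ 0 := by exact_mod_cast hs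
  have hw := ofReal_add_I_mul_ne_zero hτ t
  have ha := (hasDerivAt_one_div_sqrt_sigmaT hM hτ t).ofReal_comp
  have hb := ((((hasDerivAt_arctan_div hτ t).ofReal_comp.const_mul
    (Complex.I * (2 * (n : ℂ) + 1))).div_const 2).neg).cexp
  have hc := (((((hasDerivAt_id t).ofReal_comp.const_mul Complex.I).const_add (τ : ℂ)).inv
    hw).const_mul (-(M * (Q : ℂ) ^ 2 / 2))).cexp
  have hd := (HasDerivAt.comp t (hasDerivAt_He n (Q / sigmaT M τ t))
    ((hasDerivAt_const t Q).div (hasDerivAt_sigmaT hM hτ t) hs)).ofReal_comp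
  have h := (((ha.const_mul ((1 / Real.sqrt ((n.factorial : ℝ) * Real.sqrt (2 * Real.pi)) : ℝ)
    : ℂ)).mul hb).mul hc).mul hd
  unfold chi
  simp only [gaussian_exponent_eq hM hτ]
  refine h.congr_deriv ?_
  simp only [Function.comp, id, Pi.div_apply, Pi.mul_apply, Pi.inv_apply, Pi.neg_apply, ← div_eq_mul_inv]
  push_cast
  field_simp
  ring

theorem hasDerivAt_mul_cexp_sq_mul {a b f' : ℂ} {f : ℝ → ℂ} {q : ℝ} (hf : HasDerivAt f f' q) :
    HasDerivAt (fun x : ℝ => a * Complex.exp (b * (x : ℂ) ^ 2) * f x)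
      (a * Complex.exp (b * (q : ℂ) ^ 2) * (2 * b * q * f q + f')) q := by
  have h := (((((hasDerivAt_id q).ofReal_comp.pow 2).const_mul b).cexp).const_mul a).mul hf
  refine h.congr_deriv ?_
  simp
  ring

theorem deriv_deriv_mul_cexp_sq_mul {a b f'' : ℂ} {f f' : ℝ → ℂ} {q : ℝ}
    (hf : ∀ x, HasDerivAt f (f' x) x) (hf' : HasDerivAt f' f'' q) :
    deriv (deriv (fun x : ℝ => a * Complex.exp (b * (x : ℂ) ^ 2) * f x)) q =
      a * Complex.exp (b * (q : ℂ) ^ 2) *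
        ((2 * b + (2 * b * q) ^ 2) * f q + 2 * (2 * b * q) * f' q + f'') := by
  rw [funext fun x => (hasDerivAt_mul_cexp_sq_mul (a := a) (b := b) (hf x)).deriv]
  have h : HasDerivAt (fun x : ℝ => 2 * b * (x : ℂ) * f x + f' x)
      (2 * b * f q + 2 * b * q * f' q + f'') q := by
    refine ((((hasDerivAt_id q).ofReal_comp.const_mul (2 * b)).mul (hf q)).add hf').congr_deriv ?_
    simp
  rw [(hasDerivAt_mul_cexp_sq_mul h).deriv]
  ring

theorem deriv_deriv_chi_space {M τ : ℝ} (hM : 0 < M) (hτ : 0 < τ) (n : ℕ) (t Q : ℝ) :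
    deriv (deriv (fun q => chi M τ n t q)) Q =
      ((1 / Real.sqrt ((n.factorial : ℝ) * Real.sqrt (2 * Real.pi)) : ℝ) : ℂ) *
        ((1 / Real.sqrt (sigmaT M τ t) : ℝ) : ℂ) *
        Complex.exp (-(Complex.I * (2 * (n : ℂ) + 1) * (Real.arctan (t / τ) : ℂ) / 2)) *
        Complex.exp (-(M * (Q : ℂ) ^ 2 / 2) / (τ + Complex.I * t)) *
        ((-(M / (τ + Complex.I * t)) + (M * Q / (τ + Complex.I * t)) ^ 2) *
            (He n (Q / sigmaT M τ t) : ℂ)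
          - 2 * (M * Q / (τ + Complex.I * t)) *
            ((Polynomial.aeval (Q / sigmaT M τ t)
              (Polynomial.derivative (Polynomial.hermite n)) : ℝ) / sigmaT M τ t)
          + (Polynomial.aeval (Q / sigmaT M τ t) (Polynomial.derivative
              (Polynomial.derivative (Polynomial.hermite n))) : ℝ) / (sigmaT M τ t : ℂ) ^ 2) := by
  have hp (g : ℝ → ℝ) (p : Polynomial ℤ) (x : ℝ) (h : HasDerivAt g (Polynomial.aeval
      (x / sigmaT M τ t) p) (x / sigmaT M τ t)) :
      HasDerivAt (fun x : ℝ => (g (x / sigmaT M τ t) : ℂ))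
        ((Polynomial.aeval (x / sigmaT M τ t) p : ℝ) / sigmaT M τ t) x := by
    refine (HasDerivAt.comp x h
      ((hasDerivAt_id x).div_const (sigmaT M τ t))).ofReal_comp.congr_deriv ?_
    push_cast
    ring
  have key := deriv_deriv_mul_cexp_sq_mul (q := Q)
    (a := ((1 / Real.sqrt ((n.factorial : ℝ) * Real.sqrt (2 * Real.pi)) : ℝ) : ℂ) *
        ((1 / Real.sqrt (sigmaT M τ t) : ℝ) : ℂ) *
        Complex.exp (-(Complex.I * (2 * (n : ℂ) + 1) * (Real.arctan (t / τ) : ℂ) / 2)))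
    (b := -(M / 2) / (τ + Complex.I * t))
    (fun x => hp _ _ x (hasDerivAt_He n _))
    ((hp _ _ Q (Polynomial.hasDerivAt_aeval _ _)).div_const (sigmaT M τ t : ℂ))
  have he (x : ℂ) : -(M * x ^ 2 / 2) / (τ + Complex.I * t) =
      -(M / 2) / (τ + Complex.I * t) * x ^ 2 := by ring
  unfold chi
  simp only [gaussian_exponent_eq hM hτ, he]
  rw [key]
  ring

/-- The Gauss–Hermite wave packets solve the free nonrelativistic Schrödinger
equation `i·∂_t χ_n + (1/(2M))·∂²_Q χ_n = 0` at every `(t,Q) ∈ ℝ²`. -/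
theorem chi_solves_schrodinger (M τ : ℝ) (hM : 0 < M) (hτ : 0 < τ)
    (n : ℕ) (t Q : ℝ) :
    Complex.I * deriv (fun s : ℝ => chi M τ n s Q) t
      + (1 / (2 * (M : ℂ))) * deriv (deriv (fun q : ℝ => chi M τ n t q)) Q = 0 := by
  have hM' : (M : ℂ) ≠ 0 := by exact_mod_cast hM.ne'
  have hτ' : (τ : ℂ) ≠ 0 := by exact_mod_cast hτ.ne'
  have hs' : (sigmaT M τ t : ℂ) ≠ 0 := by exact_mod_cast (sigmaT_pos hM hτ t).ne'
  have hw := ofReal_add_I_mul_ne_zero hτ t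
  have hv := ofReal_sub_I_mul_ne_zero hτ t
  rw [(hasDerivAt_chi_time hM hτ n t Q).deriv, deriv_deriv_chi_space hM hτ,
    derivative_derivative_hermite, He_eq_aeval_hermite, ofReal_sigmaT_sq hM hτ,
    sq_add_sq_eq_mul_conj]
  simp only [map_sub, map_mul, Polynomial.aeval_X, map_natCast]
  push_cast
  generalize ((Polynomial.aeval (Q / sigmaT M τ t) (Polynomial.hermite n) : ℝ) : ℂ) = H
  generalize ((Polynomial.aeval (Q / sigmaT M τ t)
    (Polynomial.derivative (Polynomial.hermite n)) : ℝ) : ℂ) = H'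
  rw [mul_left_comm, mul_left_comm (1 / (2 * (M : ℂ))), ← mul_add]
  refine mul_eq_zero_of_right _ ?_
  field_simp
  linear_combination (H * sigmaT M τ t *
    ((τ - Complex.I * t) * M * Q ^ 2 - (2 * n + 1) * τ * (τ + Complex.I * t))) * Complex.I_sq
end

section
/- Dashen–Hasslacher–Neveu semiclassical mass shift: for each κ > 0 the function x ↦ A_κ(x) − B_κ(x) + 3m²·sech²(m x)·C_κ(x) is integrable on ℝ, the limit as κ → +∞ of (1/2)·∫_ℝ [A_κ(x) − B_κ(x) + 3m²·sech²(m x)·C_κ(x)] dx exists, and this limit equals m/(2√3) − 3m/π = −m·(3/π − 1/(2√3)). -/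
open MeasureTheory Filter

noncomputable def sech (x : ℝ) : ℝ := 1 / Real.cosh x

noncomputable def ψ₁ (m x : ℝ) : ℝ :=
  Real.sqrt (3 * m / 2) * Real.tanh (m * x) * sech (m * x)

/-- Rescaled mollifier `δ^κ(x) = κ·δ¹(κ·x)`. -/
noncomputable def moll (δ1 : ℝ → ℝ) (κ x : ℝ) : ℝ := κ * δ1 (κ * x)

/-- `M(k,x) = −k² − 3imk·tanh(m x) + 2m² − 3m²·sech²(m x)`. -/
noncomputable def Mker (m k x : ℝ) : ℂ :=
  -(k : ℂ) ^ 2 - 3 * Complex.I * (m : ℂ) * (k : ℂ) * (Real.tanh (m * x) : ℂ)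
    + 2 * (m : ℂ) ^ 2 - 3 * (m : ℂ) ^ 2 * (sech (m * x) : ℂ) ^ 2

/-- Diagonal value `K^{1/2}_κ(x,x)` of the regularized kernel of `K^{1/2}`. -/
noncomputable def Aker (m : ℝ) (δ1 : ℝ → ℝ) (κ x : ℝ) : ℝ :=
  Real.sqrt 3 * m * (∫ y : ℝ, moll δ1 κ (x - y) * ψ₁ m y) ^ 2 +
    (1 / (2 * Real.pi)) *
      ∫ k : ℝ, ‖∫ x' : ℝ, Mker m k x' * Complex.exp (Complex.I * (k : ℂ) * (x' : ℂ)) *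
          ((moll δ1 κ (x - x') : ℝ) : ℂ)‖ ^ 2 /
        ((k ^ 2 + m ^ 2) * Real.sqrt (k ^ 2 + 4 * m ^ 2))

/-- Diagonal value `K₀^{1/2}_κ(x,x)` of the regularized kernel of `K₀^{1/2}`. -/
noncomputable def Bker (m : ℝ) (δ1 : ℝ → ℝ) (κ x : ℝ) : ℝ :=
  (1 / (2 * Real.pi)) *
    ∫ k : ℝ, Real.sqrt (k ^ 2 + 4 * m ^ 2) *
      ‖∫ x' : ℝ, Complex.exp (Complex.I * (k : ℂ) * (x' : ℂ)) *
        ((moll δ1 κ (x - x') : ℝ) : ℂ)‖ ^ 2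

/-- Diagonal value `C₀^{1/2}_κ(x,x)` of the regularized kernel of `K₀^{−1/2}`. -/
noncomputable def Cker (m : ℝ) (δ1 : ℝ → ℝ) (κ x : ℝ) : ℝ :=
  (1 / (2 * Real.pi)) *
    ∫ k : ℝ, ‖∫ x' : ℝ, Complex.exp (Complex.I * (k : ℂ) * (x' : ℂ)) *
        ((moll δ1 κ (x - x') : ℝ) : ℂ)‖ ^ 2 / Real.sqrt (k ^ 2 + 4 * m ^ 2)

open scoped Topology

section Hyperbolic

lemma sech_pos (x : ℝ) : 0 < sech x := one_div_pos.mpr (Real.cosh_pos x)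

lemma sech_sq_eq (x : ℝ) : sech x ^ 2 = 1 - Real.tanh x ^ 2 := by
  have h := (Real.cosh_pos x).ne'
  rw [sech, Real.tanh_eq_sinh_div_cosh]
  field_simp
  linarith [Real.cosh_sq x]

lemma sech_le_one (x : ℝ) : sech x ≤ 1 := by
  rw [sech, div_le_one (Real.cosh_pos x)]
  exact Real.one_le_cosh x

lemma hasDerivAt_tanh (x : ℝ) : HasDerivAt Real.tanh (sech x ^ 2) x := by
  have h := (Real.cosh_pos x).ne'
  have := (Real.hasDerivAt_sinh x).div (Real.hasDerivAt_cosh x) h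
  refine (this.congr_of_eventuallyEq (.of_forall fun y => ?_)).congr_deriv ?_
  · simp [Real.tanh_eq_sinh_div_cosh]
  · rw [sech]
    field_simp
    linarith [Real.cosh_sq x]

lemma hasDerivAt_sech (x : ℝ) : HasDerivAt sech (-(Real.tanh x * sech x)) x := by
  have h := (Real.cosh_pos x).ne'
  have := (Real.hasDerivAt_cosh x).inv h
  refine (this.congr_of_eventuallyEq (.of_forall fun y => ?_)).congr_deriv ?_
  · simp [sech]
  · rw [sech, Real.tanh_eq_sinh_div_cosh]
    field_simp

@[fun_prop]
lemma continuous_tanh : Continuous Real.tanh :=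
  continuous_iff_continuousAt.mpr fun x => (hasDerivAt_tanh x).continuousAt

@[fun_prop]
lemma continuous_sech : Continuous sech :=
  continuous_iff_continuousAt.mpr fun x => (hasDerivAt_sech x).continuousAt

lemma sech_le_exp (x : ℝ) : sech x ≤ 2 * Real.exp (-|x|) := by
  rw [sech, ← Real.cosh_abs, div_le_iff₀ (Real.cosh_pos _), Real.cosh_eq]
  have h : Real.exp (-|x|) * Real.exp |x| = 1 := by rw [← Real.exp_add]; simp
  nlinarith [Real.exp_pos (-|x|)]

lemma integrable_exp_neg_mul_abs {m : ℝ} (hm : 0 < m) :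
    Integrable (fun x : ℝ => Real.exp (-(m * |x|))) := by
  refine ((integrable_inv_one_add_sq.comp_mul_left' (R := m) hm.ne').const_mul 2).mono'
    (by fun_prop) (.of_forall fun x => ?_)
  rw [Real.norm_of_nonneg (Real.exp_nonneg _), Real.exp_neg, ← div_eq_mul_inv,
    le_div_iff₀ (by positivity), inv_mul_le_iff₀ (Real.exp_pos _)]
  have h := Real.quadratic_le_exp_of_nonneg (x := m * |x|) (by positivity)
  have h2 : (m * |x|) ^ 2 = (m * x) ^ 2 := by rw [mul_pow, sq_abs, mul_pow]
  nlinarith [mul_nonneg hm.le (abs_nonneg x)]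

lemma sech_mul_sub_le {m x w w₀ : ℝ} (hm : 0 < m) (hw : |w| ≤ w₀) :
    sech (m * (x - w)) ≤ 2 * Real.exp (m * w₀) * Real.exp (-(m * |x|)) := by
  refine (sech_le_exp _).trans ?_
  rw [mul_assoc, ← Real.exp_add]
  gcongr
  rw [abs_mul, abs_of_pos hm]
  have : |x| ≤ |x - w| + |w| := by simpa using abs_add_le (x - w) w
  nlinarith

lemma abs_tanh_mul_sub_sub_le {m x w w₀ : ℝ} (hm : 0 < m) (hw : |w| ≤ w₀) :
    |Real.tanh (m * (x - w)) - Real.tanh (m * x)| ≤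
      2 * m * Real.exp (m * w₀) * Real.exp (-(m * |x|)) * |w| := by
  have h := Convex.norm_image_sub_le_of_norm_hasDerivWithin_le (s := Set.Icc (-|w|) |w|)
    (f := fun y : ℝ => Real.tanh (m * (x - y)))
    (f' := fun y : ℝ => sech (m * (x - y)) ^ 2 * (m * (-1)))
    (C := 2 * m * Real.exp (m * w₀) * Real.exp (-(m * |x|))) (x := 0) (y := w)
    (fun y _ => ((hasDerivAt_tanh _).comp y
      (((hasDerivAt_id y).const_sub x).const_mul m)).hasDerivWithinAt)
    (fun y hy => ?_) (convex_Icc _ _) (by simp) ⟨neg_abs_le w, le_abs_self w⟩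
  · simpa using h
  · have h1 := sech_mul_sub_le (x := x) hm ((abs_le.mpr hy).trans hw)
    have h2 := sech_le_one (m * (x - y))
    have h3 := sech_pos (m * (x - y))
    rw [Real.norm_eq_abs, mul_neg_one, mul_neg, abs_neg, abs_of_nonneg (by positivity)]
    calc sech (m * (x - y)) ^ 2 * m
        ≤ sech (m * (x - y)) * m := by gcongr; nlinarith
      _ ≤ 2 * Real.exp (m * w₀) * Real.exp (-(m * |x|)) * m := by gcongr
      _ = _ := by ring

lemma integrable_tanh_diff {m : ℝ} (hm : 0 < m) (w : ℝ) :
    Integrable (fun x : ℝ => Real.tanh (m * (x - w)) - Real.tanh (m * x)) := by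
  refine (((integrable_exp_neg_mul_abs hm).const_mul
    (2 * m * Real.exp (m * |w|))).mul_const |w|).mono' (by fun_prop) (.of_forall fun x => ?_)
  exact abs_tanh_mul_sub_sub_le hm le_rfl

lemma integrable_sech_sq {m : ℝ} (hm : 0 < m) : Integrable (fun x : ℝ => sech (m * x) ^ 2) := by
  refine ((integrable_exp_neg_mul_abs hm).const_mul 2).mono' (by fun_prop) (.of_forall fun x => ?_)
  have h1 := sech_mul_sub_le (x := x) (w := 0) (w₀ := 0) hm (by simp)
  have h2 := sech_le_one (m * x)
  have h3 := sech_pos (m * x)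
  simp only [sub_zero, mul_zero, Real.exp_zero, mul_one] at h1
  rw [Real.norm_of_nonneg (by positivity)]
  nlinarith

lemma tendsto_sech_atTop : Tendsto sech atTop (𝓝 0) := by
  have h : Tendsto (fun x : ℝ => 2 * Real.exp (-x)) atTop (𝓝 0) := by
    simpa using Real.tendsto_exp_neg_atTop_nhds_zero.const_mul 2
  refine squeeze_zero' (.of_forall fun x => (sech_pos x).le) ?_ h
  filter_upwards [eventually_ge_atTop 0] with x hx
  simpa [abs_of_nonneg hx] using sech_le_exp x

lemma tendsto_tanh_atTop : Tendsto Real.tanh atTop (𝓝 1) := by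
  have h : Tendsto (fun x : ℝ => 1 - Real.exp (-x) * sech x) atTop (𝓝 1) := by
    simpa using (Real.tendsto_exp_neg_atTop_nhds_zero.mul tendsto_sech_atTop).const_sub 1
  refine h.congr fun x => ?_
  have hc := (Real.cosh_pos x).ne'
  rw [Real.tanh_eq_sinh_div_cosh, sech]
  field_simp
  linarith [Real.cosh_sub_sinh x]

lemma tendsto_tanh_atBot : Tendsto Real.tanh atBot (𝓝 (-1)) := by
  have h := (tendsto_tanh_atTop.comp tendsto_neg_atBot_atTop).neg
  refine h.congr fun x => by simp

lemma integral_of_hasDerivAt_tanh {m : ℝ} (hm : 0 < m) {g g' : ℝ → ℝ}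
    (hg : ∀ y, HasDerivAt g (g' y) y)
    (hint : Integrable fun x : ℝ => g' (Real.tanh (m * x)) * sech (m * x) ^ 2) :
    ∫ x : ℝ, g' (Real.tanh (m * x)) * sech (m * x) ^ 2 = (g 1 - g (-1)) / m := by
  have h := integral_of_hasDerivAt_of_tendsto
    (f := fun x : ℝ => g (Real.tanh (m * x)) / m)
    (f' := fun x : ℝ => g' (Real.tanh (m * x)) * sech (m * x) ^ 2)
    (m := g (-1) / m) (n := g 1 / m) (fun x => ?_) hint ?_ ?_
  · rw [h, sub_div]
  · have := (((hg _).comp _ ((hasDerivAt_tanh (m * x)).comp x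
      ((hasDerivAt_id x).const_mul m))).div_const m)
    refine this.congr_deriv ?_
    simp only [Function.comp]
    field_simp
  · exact (((hg _).continuousAt.tendsto.comp tendsto_tanh_atBot).comp
      (tendsto_id.const_mul_atBot hm)).div_const m
  · exact (((hg _).continuousAt.tendsto.comp tendsto_tanh_atTop).comp
      (tendsto_id.const_mul_atTop hm)).div_const m

lemma integral_sech_sq {m : ℝ} (hm : 0 < m) : ∫ x : ℝ, sech (m * x) ^ 2 = 2 / m := by
  have h := integral_of_hasDerivAt_tanh hm (g := id) (g' := fun _ => 1) (fun y => hasDerivAt_id y)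
    (by simpa using integrable_sech_sq hm)
  simp only [one_mul, id] at h
  rw [h]; norm_num

lemma integrable_tanh_sq_mul_sech_sq {m : ℝ} (hm : 0 < m) :
    Integrable (fun x : ℝ => Real.tanh (m * x) ^ 2 * sech (m * x) ^ 2) := by
  refine (integrable_sech_sq hm).mono' (by fun_prop) (.of_forall fun x => ?_)
  rw [Real.norm_of_nonneg (by positivity)]
  exact mul_le_of_le_one_left (by positivity) (Real.tanh_sq_lt_one _).le

lemma integral_tanh_sq_mul_sech_sq {m : ℝ} (hm : 0 < m) :
    ∫ x : ℝ, Real.tanh (m * x) ^ 2 * sech (m * x) ^ 2 = 2 / (3 * m) := by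
  have h := integral_of_hasDerivAt_tanh hm (g := fun y => y ^ 3 / 3) (g' := fun y => y ^ 2)
    (fun y => ((hasDerivAt_pow 3 y).div_const 3).congr_deriv (by norm_num))
    (integrable_tanh_sq_mul_sech_sq hm)
  rw [h]; field_simp; norm_num

lemma integral_sech_pow_four {m : ℝ} (hm : 0 < m) :
    ∫ x : ℝ, sech (m * x) ^ 4 = 4 / (3 * m) := by
  have h : ∀ x : ℝ, sech (m * x) ^ 4 =
      sech (m * x) ^ 2 - Real.tanh (m * x) ^ 2 * sech (m * x) ^ 2 := fun x => by
    linear_combination (sech (m * x) ^ 2) * sech_sq_eq (m * x)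
  simp_rw [h]
  rw [integral_sub (integrable_sech_sq hm) (integrable_tanh_sq_mul_sech_sq hm),
    integral_sech_sq hm, integral_tanh_sq_mul_sech_sq hm]
  field_simp; norm_num

lemma log_cosh_eq (x : ℝ) :
    Real.log (Real.cosh x) = x - Real.log 2 + Real.log (1 + Real.exp (-2 * x)) := by
  have h : Real.cosh x = Real.exp x / 2 * (1 + Real.exp (-2 * x)) := by
    rw [Real.cosh_eq, show -x = x + -2 * x by ring, Real.exp_add]
    ring
  rw [h, Real.log_mul (by positivity) (by positivity), Real.log_div (by positivity) (by norm_num),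
    Real.log_exp]

lemma tendsto_log_cosh_diff {m : ℝ} (hm : 0 < m) (w : ℝ) :
    Tendsto (fun x : ℝ => (Real.log (Real.cosh (m * (x - w))) - Real.log (Real.cosh (m * x))) / m)
      atTop (𝓝 (-w)) := by
  have h0 : ∀ v : ℝ, Tendsto (fun x : ℝ => Real.log (1 + Real.exp (-2 * (m * (x - v)))))
      atTop (𝓝 0) := fun v => by
    have h1 : Tendsto (fun x : ℝ => 2 * m * (x + -v)) atTop atTop :=
      (tendsto_atTop_add_const_right _ _ tendsto_id).const_mul_atTop (by positivity)
    have h2 := (Real.tendsto_exp_neg_atTop_nhds_zero.comp h1).const_add 1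
    have h3 := (Real.continuousAt_log (x := 1 + 0) (by norm_num)).tendsto.comp h2
    simp only [add_zero, Real.log_one] at h3
    refine h3.congr fun x => ?_
    simp only [Function.comp]
    ring_nf
  have h := (((h0 w).sub (h0 0)).div_const m).const_add (-w)
  simp only [sub_zero, zero_div, add_zero] at h
  refine h.congr fun x => ?_
  rw [log_cosh_eq, log_cosh_eq]
  field_simp
  ring

lemma integral_tanh_diff {m : ℝ} (hm : 0 < m) (w : ℝ) :
    ∫ x : ℝ, (Real.tanh (m * (x - w)) - Real.tanh (m * x)) = -2 * w := by
  have hlog : ∀ z : ℝ, HasDerivAt (fun z => Real.log (Real.cosh z)) (Real.tanh z) z := fun z =>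
    ((Real.hasDerivAt_cosh z).log (Real.cosh_pos z).ne').congr_deriv
      (Real.tanh_eq_sinh_div_cosh z).symm
  rw [integral_of_hasDerivAt_of_tendsto (m := w) (n := -w)
    (f := fun x : ℝ =>
      (Real.log (Real.cosh (m * (x - w))) - Real.log (Real.cosh (m * x))) / m)
    (fun x => ?_) (integrable_tanh_diff hm w) ?_ (tendsto_log_cosh_diff hm w)]
  · ring
  · have h := (tendsto_log_cosh_diff hm (-w)).comp tendsto_neg_atBot_atTop
    rw [neg_neg] at h
    refine h.congr fun x => ?_
    simp only [Function.comp]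
    rw [show m * (-x - -w) = -(m * (x - w)) by ring, show m * -x = -(m * x) by ring,
      Real.cosh_neg, Real.cosh_neg]
  · have h1 := (hlog (m * (x - w))).comp x (((hasDerivAt_id x).sub_const w).const_mul m)
    have h2 := (hlog (m * x)).comp x ((hasDerivAt_id x).const_mul m)
    refine ((h1.sub h2).div_const m).congr_deriv ?_
    field_simp

end Hyperbolic

section Mollifier

/-- Smooth even functions of integral one which vanish outside `(-1, 1)`. -/
structure IsMollifier (δ1 : ℝ → ℝ) : Prop where
  smooth : ContDiff ℝ (⊤ : ℕ∞) δ1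
  even : ∀ x, δ1 (-x) = δ1 x
  eq_zero : ∀ x, 1 ≤ |x| → δ1 x = 0
  integral_eq_one : ∫ x : ℝ, δ1 x = 1

/-- Cosine transform of `f`. -/
noncomputable def cosTransform (f : ℝ → ℝ) (v : ℝ) : ℝ := ∫ u : ℝ, Real.cos (v * u) * f u

/-- Sine transform of `f`. -/
noncomputable def sinTransform (f : ℝ → ℝ) (v : ℝ) : ℝ := ∫ u : ℝ, Real.sin (v * u) * f u

lemma integral_deriv_mul_eq_neg {g g' f f' : ℝ → ℝ} (hg : ∀ u, HasDerivAt g (g' u) u)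
    (hf : ∀ u, HasDerivAt f (f' u) u) (hg' : Continuous g') (hf' : Continuous f')
    (hc : HasCompactSupport f) : ∫ u, g' u * f u = -∫ u, g u * f' u := by
  have hgc : Continuous g := continuous_iff_continuousAt.mpr fun u => (hg u).continuousAt
  have hfc : Continuous f := continuous_iff_continuousAt.mpr fun u => (hf u).continuousAt
  have hc' : HasCompactSupport f' := by
    rw [show f' = deriv f from funext fun u => ((hf u).deriv).symm]
    exact hc.deriv
  have i1 : Integrable fun u => g' u * f u :=
    (hg'.mul hfc).integrable_of_hasCompactSupport hc.mul_left
  have i2 : Integrable fun u => g u * f' u :=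
    (hgc.mul hf').integrable_of_hasCompactSupport hc'.mul_left
  have i3 : Integrable fun u => g u * f u :=
    (hgc.mul hfc).integrable_of_hasCompactSupport hc.mul_left
  have h := integral_eq_zero_of_hasDerivAt_of_integrable (fun u => (hg u).mul (hf u))
    (i1.add i2) i3
  rw [integral_add i1 i2] at h
  linarith

namespace IsMollifier

variable {δ1 : ℝ → ℝ} (hδ : IsMollifier δ1)
include hδ

lemma continuous : Continuous δ1 := hδ.smooth.continuous

lemma hasDerivAt (u : ℝ) : HasDerivAt δ1 (deriv δ1 u) u :=
  (hδ.smooth.differentiable (by simp) u).hasDerivAt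

lemma contDiff_deriv : ContDiff ℝ (⊤ : ℕ∞) (deriv δ1) :=
  (contDiff_infty_iff_deriv.mp hδ.smooth).2

lemma continuous_deriv : Continuous (deriv δ1) := hδ.contDiff_deriv.continuous

lemma hasCompactSupport : HasCompactSupport δ1 := by
  refine HasCompactSupport.intro (isCompact_Icc (a := (-1 : ℝ)) (b := 1)) fun x hx => ?_
  refine hδ.eq_zero x ?_
  by_contra! h
  exact hx ⟨(abs_lt.mp h).1.le, (abs_lt.mp h).2.le⟩

lemma deriv_eq_zero {u : ℝ} (hu : 1 < |u|) : deriv δ1 u = 0 := by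
  have h : δ1 =ᶠ[𝓝 u] fun _ => 0 := by
    filter_upwards [(isOpen_lt continuous_const continuous_abs).mem_nhds hu] with y hy
    exact hδ.eq_zero y (le_of_lt hy)
  rw [h.deriv_eq, deriv_const]

lemma integrable_mul {g : ℝ → ℝ} (hg : Continuous g) : Integrable fun u => g u * δ1 u :=
  (hg.mul hδ.continuous).integrable_of_hasCompactSupport hδ.hasCompactSupport.mul_left

lemma integrable_mul_deriv {g : ℝ → ℝ} (hg : Continuous g) :
    Integrable fun u => g u * deriv δ1 u :=
  (hg.mul hδ.continuous_deriv).integrable_of_hasCompactSupport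
    hδ.hasCompactSupport.deriv.mul_left

lemma integrable : Integrable δ1 :=
  hδ.continuous.integrable_of_hasCompactSupport hδ.hasCompactSupport

lemma integrable_deriv : Integrable (deriv δ1) :=
  hδ.continuous_deriv.integrable_of_hasCompactSupport hδ.hasCompactSupport.deriv

lemma integral_deriv_mul {g g' : ℝ → ℝ} (hg : ∀ u, HasDerivAt g (g' u) u)
    (hg' : Continuous g') : ∫ u, g' u * δ1 u = -∫ u, g u * deriv δ1 u :=
  integral_deriv_mul_eq_neg hg hδ.hasDerivAt hg' hδ.continuous_deriv hδ.hasCompactSupport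

lemma sinTransform_eq_zero (v : ℝ) : sinTransform δ1 v = 0 := by
  have h : sinTransform δ1 v = -sinTransform δ1 v := by
    conv_lhs => rw [sinTransform, ← integral_neg_eq_self]
    rw [sinTransform, ← integral_neg]
    simp [hδ.even]
  linarith

lemma sinTransform_deriv (v : ℝ) : sinTransform (deriv δ1) v = -(v * cosTransform δ1 v) := by
  have h := hδ.integral_deriv_mul (g := fun u => Real.sin (v * u))
    (g' := fun u => Real.cos (v * u) * (v * 1))
    (fun u => (Real.hasDerivAt_sin _).comp u ((hasDerivAt_id u).const_mul v)) (by fun_prop)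
  rw [sinTransform, cosTransform, ← integral_const_mul, ← neg_eq_iff_eq_neg, ← h]
  congr with u
  ring

lemma cosTransform_deriv (v : ℝ) : cosTransform (deriv δ1) v = 0 := by
  have h := hδ.integral_deriv_mul (g := fun u => Real.cos (v * u))
    (g' := fun u => -Real.sin (v * u) * (v * 1))
    (fun u => (Real.hasDerivAt_cos _).comp u ((hasDerivAt_id u).const_mul v)) (by fun_prop)
  have h0 := hδ.sinTransform_eq_zero v
  rw [sinTransform] at h0
  rw [cosTransform, ← neg_eq_zero, ← h, ← neg_eq_zero, ← integral_neg, ← mul_zero v, ← h0,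
    ← integral_const_mul]
  congr with u
  ring

lemma cosTransform_id_mul_deriv (v : ℝ) :
    cosTransform (fun u => u * deriv δ1 u) v =
      -cosTransform δ1 v + v * sinTransform (fun u => u * δ1 u) v := by
  have h := hδ.integral_deriv_mul (g := fun u => Real.cos (v * u) * u)
    (g' := fun u => (-Real.sin (v * u) * (v * 1)) * u + Real.cos (v * u) * 1)
    (fun u => ((Real.hasDerivAt_cos _).comp u ((hasDerivAt_id u).const_mul v)).mul
      (hasDerivAt_id u)) (by fun_prop)
  have h1 : ∫ u, ((-Real.sin (v * u) * (v * 1)) * u + Real.cos (v * u) * 1) * δ1 u =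
      -(v * sinTransform (fun u => u * δ1 u) v) + cosTransform δ1 v := by
    rw [sinTransform, cosTransform, ← integral_const_mul, ← integral_neg, ← integral_add]
    · congr with u
      ring
    · exact (hδ.integrable_mul (g := fun u => -(v * (Real.sin (v * u) * u))) (by fun_prop)).congr
        (.of_forall fun u => by ring)
    · exact hδ.integrable_mul (by fun_prop)
  rw [h1] at h
  rw [cosTransform]
  simp only [mul_assoc] at h
  linarith

lemma hasDerivAt_cosTransform (v : ℝ) :
    HasDerivAt (cosTransform δ1) (-sinTransform (fun u => u * δ1 u) v) v := by
  have h := (hasDerivAt_integral_of_dominated_loc_of_deriv_le (μ := volume) (x₀ := v)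
    (s := Set.univ) (F := fun v u => Real.cos (v * u) * δ1 u)
    (F' := fun v u => (-Real.sin (v * u) * (1 * u)) * δ1 u) (bound := fun u => |u| * |δ1 u|)
    univ_mem ?_ ?_ ?_ ?_ ?_ ?_).2
  · refine h.congr_deriv ?_
    rw [sinTransform, ← integral_neg]
    congr with u
    ring
  · have := hδ.continuous
    exact .of_forall fun v => by fun_prop
  · exact hδ.integrable_mul (by fun_prop)
  · have := hδ.continuous
    fun_prop
  · refine .of_forall fun u v _ => ?_
    rw [norm_mul, norm_mul, one_mul, norm_neg]
    exact mul_le_mul_of_nonneg_right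
      (mul_le_of_le_one_left (abs_nonneg u) (Real.abs_sin_le_one _)) (abs_nonneg _)
  · exact (hδ.integrable_mul continuous_id).abs.congr (.of_forall fun u => abs_mul _ _)
  · refine .of_forall fun u v _ => ?_
    exact ((Real.hasDerivAt_cos _).comp v ((hasDerivAt_id v).mul_const u)).mul_const _

lemma continuous_cosTransform : Continuous (cosTransform δ1) :=
  continuous_iff_continuousAt.mpr fun v => (hδ.hasDerivAt_cosTransform v).continuousAt

lemma cosTransform_zero : cosTransform δ1 0 = 1 := by
  simp [cosTransform, hδ.integral_eq_one]

lemma exists_abs_cosTransform_le :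
    ∃ C, 0 < C ∧ ∀ v, |cosTransform δ1 v| ≤ C * (1 + v ^ 2)⁻¹ := by
  have hd : ∀ u, HasDerivAt (deriv δ1) (deriv (deriv δ1) u) u := fun u =>
    (hδ.contDiff_deriv.differentiable (by simp) u).hasDerivAt
  have hdc : Continuous (deriv (deriv δ1)) :=
    (contDiff_infty_iff_deriv.mp hδ.contDiff_deriv).2.continuous
  have key : ∀ v, v ^ 2 * cosTransform δ1 v = -cosTransform (deriv (deriv δ1)) v := fun v => by
    have h := integral_deriv_mul_eq_neg (g := fun u => -Real.cos (v * u))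
      (g' := fun u => -(-Real.sin (v * u) * (v * 1)))
      (fun u => ((Real.hasDerivAt_cos _).comp u ((hasDerivAt_id u).const_mul v)).neg) hd
      (by fun_prop) hdc hδ.hasCompactSupport.deriv
    have h1 : ∫ u, -(-Real.sin (v * u) * (v * 1)) * deriv δ1 u =
        v * sinTransform (deriv δ1) v := by
      rw [sinTransform, ← integral_const_mul]
      congr with u
      ring
    have h2 : -∫ u, -Real.cos (v * u) * deriv (deriv δ1) u =
        cosTransform (deriv (deriv δ1)) v := by
      rw [cosTransform, ← integral_neg]
      congr with u
      ring
    rw [h1, h2, hδ.sinTransform_deriv] at h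
    linarith
  have bound : ∀ (f : ℝ → ℝ), Integrable f → ∀ v, |cosTransform f v| ≤ ∫ u, |f u| :=
    fun f hf v => norm_integral_le_of_norm_le (f := fun u => Real.cos (v * u) * f u) hf.abs
      (.of_forall fun u => by
        rw [norm_mul]
        exact mul_le_of_le_one_left (abs_nonneg _) (Real.abs_cos_le_one _))
  have hdi : Integrable (deriv (deriv δ1)) :=
    hdc.integrable_of_hasCompactSupport hδ.hasCompactSupport.deriv.deriv
  refine ⟨(∫ u, |δ1 u|) + (∫ u, |deriv (deriv δ1) u|) + 1, ?_, fun v => ?_⟩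
  · positivity
  · rw [← div_eq_mul_inv, le_div_iff₀ (by positivity)]
    have h1 := bound _ hδ.integrable v
    have h2 := bound _ hdi v
    have h3 : v ^ 2 * |cosTransform δ1 v| = |cosTransform (deriv (deriv δ1)) v| := by
      rw [← abs_neg (cosTransform (deriv (deriv δ1)) v), ← key, abs_mul,
        abs_of_nonneg (sq_nonneg v)]
    nlinarith

lemma integrable_cosTransform : Integrable (cosTransform δ1) := by
  obtain ⟨C, -, h⟩ := hδ.exists_abs_cosTransform_le
  exact (integrable_inv_one_add_sq.const_mul C).mono'
    hδ.continuous_cosTransform.aestronglyMeasurable (.of_forall h)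

lemma exists_abs_cosTransform_le_const : ∃ C, 0 < C ∧ ∀ v, |cosTransform δ1 v| ≤ C := by
  obtain ⟨C, hC, h⟩ := hδ.exists_abs_cosTransform_le
  refine ⟨C, hC, fun v => (h v).trans (mul_le_of_le_one_right hC.le ?_)⟩
  exact inv_le_one_of_one_le₀ (by nlinarith [sq_nonneg v])

lemma exists_abs_sinTransform_id_mul_le :
    ∃ C, 0 < C ∧ ∀ v, |sinTransform (fun u => u * δ1 u) v| ≤ C := by
  have hi : Integrable (fun u => u * δ1 u) := hδ.integrable_mul continuous_id
  refine ⟨(∫ u, |u * δ1 u|) + 1, by positivity, fun v => ?_⟩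
  refine (norm_integral_le_of_norm_le (f := fun u => Real.sin (v * u) * (u * δ1 u)) hi.abs
    (.of_forall fun u => ?_)).trans (le_add_of_nonneg_right zero_le_one)
  rw [norm_mul]
  exact mul_le_of_le_one_left (abs_nonneg _) (Real.abs_sin_le_one _)

lemma continuous_sinTransform_id_mul : Continuous (sinTransform (fun u => u * δ1 u)) := by
  have := hδ.continuous
  refine continuous_of_dominated (F := fun v u => Real.sin (v * u) * (u * δ1 u))
    (bound := fun u => |u * δ1 u|)
    (fun v => by fun_prop) (fun v => .of_forall fun u => ?_)
    (hδ.integrable_mul continuous_id).abs (.of_forall fun u => by fun_prop)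
  rw [norm_mul]
  exact mul_le_of_le_one_left (abs_nonneg _) (Real.abs_sin_le_one _)

lemma tendsto_cosTransform_zero {l : Filter ℝ} (hl : l ≤ cocompact ℝ) :
    Tendsto (cosTransform δ1) l (𝓝 0) := by
  obtain ⟨C, -, h⟩ := hδ.exists_abs_cosTransform_le
  have h0 : Tendsto (fun v : ℝ => C * (1 + v ^ 2)⁻¹) (cocompact ℝ) (𝓝 0) := by
    have h1 : Tendsto (fun v : ℝ => 1 + ‖v‖ ^ 2) (cocompact ℝ) atTop :=
      tendsto_atTop_add_const_left _ _
        ((tendsto_pow_atTop two_ne_zero).comp (tendsto_norm_cocompact_atTop (E := ℝ)))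
    simpa using (tendsto_inv_atTop_zero.comp h1).const_mul C
  exact squeeze_zero_norm h (h0.mono_left hl)

/-- The integral of `-(c²/2)'` over `(0, ∞)` minus that over `(-∞, 0)`, where
`c = cosTransform δ1`. -/
lemma integral_sign_mul_cosTransform :
    ∫ v, v / |v| * (cosTransform δ1 v * sinTransform (fun u => u * δ1 u) v) = 1 := by
  set c := cosTransform δ1
  set s := sinTransform (fun u => u * δ1 u)
  have hder : ∀ v, HasDerivAt (fun v => -(c v ^ 2 / 2)) (c v * s v) v := fun v =>
    (((hδ.hasDerivAt_cosTransform v).pow 2).div_const 2).neg.congr_deriv (by simp; ring)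
  obtain ⟨C, -, hC⟩ := hδ.exists_abs_sinTransform_id_mul_le
  have hint : Integrable fun v => c v * s v :=
    hδ.integrable_cosTransform.mul_bdd (c := C)
      hδ.continuous_sinTransform_id_mul.aestronglyMeasurable (.of_forall hC)
  have hlim : ∀ l : Filter ℝ, l ≤ cocompact ℝ → Tendsto (fun v => -(c v ^ 2 / 2)) l (𝓝 0) :=
    fun l hl => by simpa using (((hδ.tendsto_cosTransform_zero hl).pow 2).div_const 2).neg
  have h1 := integral_Ioi_of_hasDerivAt_of_tendsto' (a := 0) (fun v _ => hder v)
    hint.integrableOn (hlim atTop atTop_le_cocompact)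
  have h2 := integral_Iic_of_hasDerivAt_of_tendsto' (a := 0) (fun v _ => hder v)
    hint.integrableOn (hlim atBot atBot_le_cocompact)
  have hc0 : c 0 = 1 := hδ.cosTransform_zero
  rw [hc0] at h1 h2
  have hsi : Integrable fun v => v / |v| * (c v * s v) := by
    refine hint.bdd_mul (c := 1)
      (measurable_id.div measurable_norm).aestronglyMeasurable (.of_forall fun v => ?_)
    · rcases lt_trichotomy v 0 with h | h | h <;> simp [h, abs_of_neg, abs_of_pos, div_self_le_one]
  rw [← integral_add_compl (measurableSet_Ioi (a := (0 : ℝ))) hsi, Set.compl_Ioi]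
  have e1 : ∫ v in Set.Ioi 0, v / |v| * (c v * s v) =
      ∫ v in Set.Ioi 0, c v * s v :=
    setIntegral_congr_fun measurableSet_Ioi fun v (hv : 0 < v) => by simp [abs_of_pos hv, hv.ne']
  have e2 : ∫ v in Set.Iic 0, v / |v| * (c v * s v) =
      -∫ v in Set.Iic 0, c v * s v := by
    rw [← integral_neg, integral_Iic_eq_integral_Iio, integral_Iic_eq_integral_Iio]
    exact setIntegral_congr_fun measurableSet_Iio fun v (hv : v < 0) => by
      simp [abs_of_neg hv, hv.ne]
  rw [e1, e2, h1, h2]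
  norm_num

end IsMollifier

end Mollifier

section KernelRepresentation

lemma integral_moll_smul {E : Type*} [NormedAddCommGroup E] [NormedSpace ℝ E]
    (δ1 : ℝ → ℝ) {κ : ℝ} (hκ : 0 < κ) (F : ℝ → E) (x : ℝ) :
    ∫ y : ℝ, moll δ1 κ (x - y) • F y = ∫ u : ℝ, δ1 u • F (x - u / κ) := by
  rw [← integral_sub_left_eq_self (fun y => moll δ1 κ (x - y) • F y) volume x]
  have h := Measure.integral_comp_mul_left (fun u => δ1 u • F (x - u / κ)) κ
  rw [abs_of_pos (inv_pos.mpr hκ)] at h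
  rw [← one_smul ℝ (∫ u, δ1 u • _), ← mul_inv_cancel₀ hκ.ne', mul_smul, ← h, ← integral_smul]
  congr with y
  rw [moll, sub_sub_cancel, mul_div_cancel_left₀ _ hκ.ne', smul_smul]

lemma norm_sq_integral_exp_mul_moll {δ1 : ℝ → ℝ} (hδ : IsMollifier δ1) {κ : ℝ} (hκ : 0 < κ)
    {a b : ℝ → ℝ} (ha : Continuous a) (hb : Continuous b) (k x : ℝ) :
    ‖∫ x' : ℝ, ((a x' : ℂ) + b x' * Complex.I) * Complex.exp (Complex.I * (k : ℂ) * (x' : ℂ)) *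
        ((moll δ1 κ (x - x') : ℝ) : ℂ)‖ ^ 2 =
      (∫ u, (a (x - u / κ) * Real.cos (k / κ * u) + b (x - u / κ) * Real.sin (k / κ * u))
        * δ1 u) ^ 2 +
      (∫ u, (b (x - u / κ) * Real.cos (k / κ * u) - a (x - u / κ) * Real.sin (k / κ * u))
        * δ1 u) ^ 2 := by
  set X : ℝ → ℝ := fun u =>
    (a (x - u / κ) * Real.cos (k / κ * u) + b (x - u / κ) * Real.sin (k / κ * u)) * δ1 u with hX
  set Y : ℝ → ℝ := fun u =>
    (b (x - u / κ) * Real.cos (k / κ * u) - a (x - u / κ) * Real.sin (k / κ * u)) * δ1 u with hY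
  have hXi : Integrable X := hδ.integrable_mul (by fun_prop)
  have hYi : Integrable Y := hδ.integrable_mul (by fun_prop)
  have h := integral_moll_smul δ1 hκ
    (fun x' : ℝ => ((a x' : ℂ) + b x' * Complex.I) * Complex.exp (Complex.I * k * x')) x
  have e1 : ∫ x' : ℝ, ((a x' : ℂ) + b x' * Complex.I) *
      Complex.exp (Complex.I * (k : ℂ) * (x' : ℂ)) * ((moll δ1 κ (x - x') : ℝ) : ℂ) =
      Complex.exp (Complex.I * (k * x : ℝ)) * ((∫ u, X u : ℝ) + (∫ u, Y u : ℝ) * Complex.I) := by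
    rw [← integral_complex_ofReal, ← integral_complex_ofReal, ← integral_mul_const,
      ← integral_add hXi.ofReal (hYi.ofReal.mul_const _), ← integral_const_mul]
    refine Eq.trans ?_ (h.trans ?_)
    · congr with x'
      rw [Complex.real_smul]
      ring
    · congr with u
      have he : Complex.exp (Complex.I * k * ((x - u / κ : ℝ) : ℂ)) =
          Complex.exp (Complex.I * (k * x : ℝ)) *
            (Real.cos (k / κ * u) - Real.sin (k / κ * u) * Complex.I) := by
        rw [Complex.ofReal_cos, Complex.ofReal_sin, ← Complex.cos_neg,
          show ∀ z : ℂ, Complex.cos (-z) - Complex.sin z * Complex.I =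
            Complex.cos (-z) + Complex.sin (-z) * Complex.I from fun z => by
              rw [Complex.sin_neg]; ring, ← Complex.exp_mul_I, ← Complex.exp_add]
        congr 1
        push_cast
        ring
      rw [Complex.real_smul, he, hX, hY]
      push_cast
      linear_combination (-(b (x - u / κ) : ℂ) * Complex.sin (k / κ * u) * (δ1 u : ℂ) *
        Complex.exp (Complex.I * (k * x))) * Complex.I_sq
  rw [e1, norm_mul, mul_comm Complex.I, Complex.norm_exp_ofReal_mul_I, one_mul,
    ← Complex.normSq_eq_norm_sq, Complex.normSq_add_mul_I]

/-- The rescaled increment of `tanh (m ·)`, times the derivative of the mollifier. -/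
noncomputable def tanhIncr (m : ℝ) (δ1 : ℝ → ℝ) (κ x u : ℝ) : ℝ :=
  κ * (Real.tanh (m * (x - u / κ)) - Real.tanh (m * x)) * deriv δ1 u

variable {δ1 : ℝ → ℝ} (hδ : IsMollifier δ1) {κ : ℝ} (hκ : 0 < κ)
include hδ hκ

lemma norm_sq_integral_exp_mul_moll_eq (k x : ℝ) :
    ‖∫ x' : ℝ, Complex.exp (Complex.I * (k : ℂ) * (x' : ℂ)) *
        ((moll δ1 κ (x - x') : ℝ) : ℂ)‖ ^ 2 = cosTransform δ1 (k / κ) ^ 2 := by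
  have h := norm_sq_integral_exp_mul_moll hδ hκ (a := fun _ => 1) (b := fun _ => 0)
    continuous_const continuous_const k x
  have h0 := hδ.sinTransform_eq_zero (k / κ)
  simp only [Complex.ofReal_one, Complex.ofReal_zero, zero_mul, add_zero, one_mul, zero_sub,
    neg_mul, integral_neg] at h
  rw [h, cosTransform]
  rw [sinTransform] at h0
  rw [h0]
  ring

lemma norm_sq_integral_Mker_mul_moll (m k x : ℝ) :
    ‖∫ x' : ℝ, Mker m k x' * Complex.exp (Complex.I * (k : ℂ) * (x' : ℂ)) *
          ((moll δ1 κ (x - x') : ℝ) : ℂ)‖ ^ 2 =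
      ((2 * m ^ 2 - k ^ 2) * cosTransform δ1 (k / κ)
        - 3 * m * cosTransform (tanhIncr m δ1 κ x) (k / κ)) ^ 2 +
      (3 * m * (sinTransform (tanhIncr m δ1 κ x) (k / κ)
        - Real.tanh (m * x) * (k * cosTransform δ1 (k / κ)))) ^ 2 := by
  have h := norm_sq_integral_exp_mul_moll hδ hκ
    (a := fun y => 2 * m ^ 2 - k ^ 2 - 3 * m ^ 2 * sech (m * y) ^ 2)
    (b := fun y => -(3 * m * k * Real.tanh (m * y))) (by fun_prop) (by fun_prop) k x
  have hM : ∀ y : ℝ, Mker m k y =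
      ((2 * m ^ 2 - k ^ 2 - 3 * m ^ 2 * sech (m * y) ^ 2 : ℝ) : ℂ)
        + ((-(3 * m * k * Real.tanh (m * y)) : ℝ) : ℂ) * Complex.I := fun y => by
    rw [Mker]
    push_cast
    ring
  simp_rw [hM]
  rw [h]
  set v := k / κ with hv
  have hk : k = κ * v := by rw [hv]; field_simp
  have hT : ∀ u, HasDerivAt (fun u : ℝ => Real.tanh (m * (x - u / κ)))
      (sech (m * (x - u / κ)) ^ 2 * (m * (-(1 / κ)))) u := fun u =>
    (hasDerivAt_tanh _).comp u ((((hasDerivAt_id u).div_const κ).const_sub x).const_mul m)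
  have hcos := hδ.integral_deriv_mul
    (fun u => ((Real.hasDerivAt_cos _).comp u ((hasDerivAt_id u).const_mul v)).mul (hT u))
    (by simp only [Function.comp]; fun_prop)
  have hsin := hδ.integral_deriv_mul
    (fun u => ((Real.hasDerivAt_sin _).comp u ((hasDerivAt_id u).const_mul v)).mul (hT u))
    (by simp only [Function.comp]; fun_prop)
  have hc0 := hδ.cosTransform_deriv v
  have hs0 := hδ.sinTransform_deriv v
  have hs1 := hδ.sinTransform_eq_zero v
  have ic : Integrable fun u : ℝ =>
      (Real.cos (v * u) * Real.tanh (m * (x - u / κ))) * deriv δ1 u :=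
    hδ.integrable_mul_deriv (by fun_prop)
  have is : Integrable fun u : ℝ =>
      (Real.sin (v * u) * Real.tanh (m * (x - u / κ))) * deriv δ1 u :=
    hδ.integrable_mul_deriv (by fun_prop)
  have hP : cosTransform (tanhIncr m δ1 κ x) v =
      κ * (∫ u, (Real.cos (v * u) * Real.tanh (m * (x - u / κ))) * deriv δ1 u)
        - κ * Real.tanh (m * x) * cosTransform (deriv δ1) v := by
    rw [cosTransform, cosTransform, ← integral_const_mul, ← integral_const_mul, ← integral_sub]
    · congr with u
      rw [tanhIncr]
      ring
    · exact ic.const_mul _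
    · exact (hδ.integrable_mul_deriv (by fun_prop)).const_mul _
  have hQ : sinTransform (tanhIncr m δ1 κ x) v =
      κ * (∫ u, (Real.sin (v * u) * Real.tanh (m * (x - u / κ))) * deriv δ1 u)
        - κ * Real.tanh (m * x) * sinTransform (deriv δ1) v := by
    rw [sinTransform, sinTransform, ← integral_const_mul, ← integral_const_mul, ← integral_sub]
    · congr with u
      rw [tanhIncr]
      ring
    · exact is.const_mul _
    · exact (hδ.integrable_mul_deriv (by fun_prop)).const_mul _
  simp only [Pi.mul_apply, Function.comp, id] at hcos hsin
  have hX : ∫ u, ((2 * m ^ 2 - k ^ 2 - 3 * m ^ 2 * sech (m * (x - u / κ)) ^ 2) * Real.cos (v * u)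
        + -(3 * m * k * Real.tanh (m * (x - u / κ))) * Real.sin (v * u)) * δ1 u =
      (2 * m ^ 2 - k ^ 2) * cosTransform δ1 v
        - 3 * m * cosTransform (tanhIncr m δ1 κ x) v := by
    rw [hP, hc0, mul_zero, sub_zero, ← neg_neg (∫ u, _ * deriv δ1 u), ← hcos, cosTransform,
      mul_neg, mul_neg, sub_neg_eq_add, ← mul_assoc, ← integral_const_mul, ← integral_const_mul,
      ← integral_add]
    · congr with u
      rw [hk]
      field_simp
      ring
    · exact (hδ.integrable_mul (by fun_prop)).const_mul _
    · exact (hδ.integrable_mul (by fun_prop)).const_mul _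
  have hY : ∫ u, (-(3 * m * k * Real.tanh (m * (x - u / κ))) * Real.cos (v * u)
        - (2 * m ^ 2 - k ^ 2 - 3 * m ^ 2 * sech (m * (x - u / κ)) ^ 2) * Real.sin (v * u)) * δ1 u =
      3 * m * (sinTransform (tanhIncr m δ1 κ x) v
        - Real.tanh (m * x) * (k * cosTransform δ1 v)) := by
    have e : 3 * m * (sinTransform (tanhIncr m δ1 κ x) v
        - Real.tanh (m * x) * (k * cosTransform δ1 v)) =
        -(3 * m * κ) * -(∫ u, (Real.sin (v * u) * Real.tanh (m * (x - u / κ))) * deriv δ1 u)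
          - (2 * m ^ 2 - k ^ 2) * sinTransform δ1 v := by
      rw [hQ, hs0, hs1, hk]
      ring
    rw [e, ← hsin, sinTransform, ← integral_const_mul, ← integral_const_mul, ← integral_sub]
    · congr with u
      rw [hk]
      field_simp
      ring
    · exact (hδ.integrable_mul (by fun_prop)).const_mul _
    · exact (hδ.integrable_mul (by fun_prop)).const_mul _
  rw [hX, hY]

end KernelRepresentation

section TanhIncrement

variable {m : ℝ} {δ1 : ℝ → ℝ} {κ₀ κ : ℝ}

lemma abs_tanhIncr_le (hm : 0 < m) (hδ : IsMollifier δ1) (hκ₀ : 0 < κ₀) (hκ : κ₀ ≤ κ) (x u : ℝ) :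
    |tanhIncr m δ1 κ x u| ≤
      2 * m * Real.exp (m * κ₀⁻¹) * Real.exp (-(m * |x|)) * |deriv δ1 u| := by
  have hκ' : 0 < κ := hκ₀.trans_le hκ
  rcases lt_or_ge 1 |u| with hu | hu
  · simp [tanhIncr, hδ.deriv_eq_zero hu]
  have hw : |u / κ| ≤ κ₀⁻¹ := by
    rw [abs_div, abs_of_pos hκ', ← one_div]
    gcongr
  have h := abs_tanh_mul_sub_sub_le (x := x) hm hw
  rw [tanhIncr, abs_mul, abs_mul, abs_of_pos hκ']
  refine mul_le_mul_of_nonneg_right ?_ (abs_nonneg _)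
  calc κ * |Real.tanh (m * (x - u / κ)) - Real.tanh (m * x)|
      ≤ κ * (2 * m * Real.exp (m * κ₀⁻¹) * Real.exp (-(m * |x|)) * |u / κ|) := by gcongr
    _ = 2 * m * Real.exp (m * κ₀⁻¹) * Real.exp (-(m * |x|)) * |u| := by
        rw [abs_div, abs_of_pos hκ']
        field_simp
    _ ≤ _ := mul_le_of_le_one_right (by positivity) hu

lemma abs_integral_mul_tanhIncr_le (hm : 0 < m) (hδ : IsMollifier δ1) (hκ₀ : 0 < κ₀) (hκ : κ₀ ≤ κ)
    {g : ℝ → ℝ} (hg : ∀ u, |g u| ≤ 1) (x : ℝ) :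
    |∫ u, g u * tanhIncr m δ1 κ x u| ≤
      2 * m * Real.exp (m * κ₀⁻¹) * (∫ u, |deriv δ1 u|) * Real.exp (-(m * |x|)) := by
  refine (norm_integral_le_of_norm_le (f := fun u => g u * tanhIncr m δ1 κ x u)
    (hδ.integrable_deriv.abs.const_mul
      (2 * m * Real.exp (m * κ₀⁻¹) * Real.exp (-(m * |x|)))) (.of_forall fun u => ?_)).trans ?_
  · rw [norm_mul]
    exact (mul_le_of_le_one_left (norm_nonneg _) (hg u)).trans (abs_tanhIncr_le hm hδ hκ₀ hκ x u)
  · rw [integral_const_mul]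
    exact le_of_eq (by ring)

lemma exists_abs_transform_tanhIncr_le (hm : 0 < m) (hδ : IsMollifier δ1) (hκ₀ : 0 < κ₀) :
    ∃ C, 0 < C ∧ ∀ κ, κ₀ ≤ κ → ∀ x v,
      |cosTransform (tanhIncr m δ1 κ x) v| ≤ C * Real.exp (-(m * |x|)) ∧
      |sinTransform (tanhIncr m δ1 κ x) v| ≤ C * Real.exp (-(m * |x|)) := by
  refine ⟨2 * m * Real.exp (m * κ₀⁻¹) * (∫ u, |deriv δ1 u|) + 1, by positivity,
    fun κ hκ x v => ⟨?_, ?_⟩⟩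
  · refine (abs_integral_mul_tanhIncr_le hm hδ hκ₀ hκ (fun u => Real.abs_cos_le_one _) x).trans ?_
    gcongr
    exact le_add_of_nonneg_right zero_le_one
  · refine (abs_integral_mul_tanhIncr_le hm hδ hκ₀ hκ (fun u => Real.abs_sin_le_one _) x).trans ?_
    gcongr
    exact le_add_of_nonneg_right zero_le_one

lemma measurable_cosTransform_tanhIncr (hδ : IsMollifier δ1) :
    Measurable fun p : ℝ × ℝ => cosTransform (tanhIncr m δ1 κ p.1) (p.2 / κ) := by
  have hd := hδ.continuous_deriv
  have h : Continuous (Function.uncurry fun (p : ℝ × ℝ) (u : ℝ) =>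
      Real.cos (p.2 / κ * u) * tanhIncr m δ1 κ p.1 u) := by
    unfold tanhIncr Function.uncurry
    fun_prop
  exact h.stronglyMeasurable.integral_prod_right.measurable

lemma measurable_sinTransform_tanhIncr (hδ : IsMollifier δ1) :
    Measurable fun p : ℝ × ℝ => sinTransform (tanhIncr m δ1 κ p.1) (p.2 / κ) := by
  have hd := hδ.continuous_deriv
  have h : Continuous (Function.uncurry fun (p : ℝ × ℝ) (u : ℝ) =>
      Real.sin (p.2 / κ * u) * tanhIncr m δ1 κ p.1 u) := by
    unfold tanhIncr Function.uncurry
    fun_prop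
  exact h.stronglyMeasurable.integral_prod_right.measurable

lemma integral_cosTransform_tanhIncr (hm : 0 < m) (hδ : IsMollifier δ1) (hκ : 0 < κ) (v : ℝ) :
    ∫ x, cosTransform (tanhIncr m δ1 κ x) v = -2 * cosTransform (fun u => u * deriv δ1 u) v := by
  have hd := hδ.continuous_deriv
  have hi : Integrable (Function.uncurry fun x u : ℝ => Real.cos (v * u) * tanhIncr m δ1 κ x u)
      (volume.prod volume) := by
    refine (((integrable_exp_neg_mul_abs hm).mul_prod hδ.integrable_deriv.abs).const_mul
      (2 * m * Real.exp (m * κ⁻¹))).mono' ?_ (.of_forall fun p => ?_)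
    · refine Continuous.aestronglyMeasurable ?_
      unfold tanhIncr Function.uncurry
      fun_prop
    · rw [Function.uncurry, norm_mul]
      refine (mul_le_of_le_one_left (norm_nonneg _) (Real.abs_cos_le_one _)).trans
        ((abs_tanhIncr_le hm hδ hκ le_rfl p.1 p.2).trans (le_of_eq ?_))
      ring
  simp only [cosTransform]
  rw [integral_integral_swap hi, ← integral_const_mul]
  congr with u
  have h : ∀ x, Real.cos (v * u) * tanhIncr m δ1 κ x u =
      (Real.cos (v * u) * κ * deriv δ1 u) *
        (Real.tanh (m * (x - u / κ)) - Real.tanh (m * x)) := fun x => by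
    rw [tanhIncr]
    ring
  simp_rw [h]
  rw [integral_const_mul, integral_tanh_diff hm]
  field_simp

lemma tendsto_tanhIncr (x u : ℝ) :
    Tendsto (fun κ => tanhIncr m δ1 κ x u) atTop
      (𝓝 (-(m * sech (m * x) ^ 2) * (u * deriv δ1 u))) := by
  have hT : HasDerivAt (fun r : ℝ => Real.tanh (m * (x - u * r)))
      (sech (m * (x - u * 0)) ^ 2 * (m * (-(u * 1)))) 0 :=
    (hasDerivAt_tanh _).comp (0 : ℝ)
      ((((hasDerivAt_id (0 : ℝ)).const_mul u).const_sub x).const_mul m)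
  have h := (hT.tendsto_slope_zero_right.comp tendsto_inv_atTop_nhdsGT_zero).mul_const (deriv δ1 u)
  refine (h.congr' ?_).trans (le_of_eq ?_)
  · filter_upwards [eventually_gt_atTop 0] with κ hκ
    simp [tanhIncr, div_eq_mul_inv]
  · congr 1
    simp
    ring

lemma tendsto_integral_mul_tanhIncr (hm : 0 < m) (hδ : IsMollifier δ1) {g : ℝ → ℝ}
    (hg : Continuous g) (hg1 : ∀ r, |g r| ≤ 1) (x k : ℝ) :
    Tendsto (fun κ => ∫ u, g (k / κ * u) * tanhIncr m δ1 κ x u) atTop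
      (𝓝 (g 0 * (m * sech (m * x) ^ 2))) := by
  have hd := hδ.continuous_deriv
  have e : g 0 * (m * sech (m * x) ^ 2) =
      ∫ u, g 0 * (-(m * sech (m * x) ^ 2) * (u * deriv δ1 u)) := by
    have h1 := hδ.cosTransform_id_mul_deriv 0
    simp only [cosTransform, zero_mul, Real.cos_zero, one_mul, add_zero, hδ.integral_eq_one] at h1
    rw [integral_const_mul, integral_const_mul, h1]
    ring
  rw [e]
  refine tendsto_integral_filter_of_dominated_convergence
    (fun u => 2 * m * Real.exp (m * 1⁻¹) * Real.exp (-(m * |x|)) * |deriv δ1 u|)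
    (.of_forall fun κ => ?_) ?_ (hδ.integrable_deriv.abs.const_mul _) (.of_forall fun u => ?_)
  · refine Continuous.aestronglyMeasurable ?_
    unfold tanhIncr
    fun_prop
  · filter_upwards [eventually_ge_atTop 1] with κ hκ
    refine .of_forall fun u => ?_
    rw [norm_mul]
    exact (mul_le_of_le_one_left (norm_nonneg _) (hg1 _)).trans
      (abs_tanhIncr_le hm hδ one_pos hκ x u)
  · refine Tendsto.mul ((hg.tendsto 0).comp ?_) (tendsto_tanhIncr x u)
    simpa using (tendsto_const_nhds (x := k).div_atTop tendsto_id).mul_const u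

lemma tendsto_cosTransform_tanhIncr (hm : 0 < m) (hδ : IsMollifier δ1) (x k : ℝ) :
    Tendsto (fun κ => cosTransform (tanhIncr m δ1 κ x) (k / κ)) atTop
      (𝓝 (m * sech (m * x) ^ 2)) := by
  simpa [cosTransform] using tendsto_integral_mul_tanhIncr hm hδ Real.continuous_cos
    Real.abs_cos_le_one x k

lemma tendsto_sinTransform_tanhIncr (hm : 0 < m) (hδ : IsMollifier δ1) (x k : ℝ) :
    Tendsto (fun κ => sinTransform (tanhIncr m δ1 κ x) (k / κ)) atTop (𝓝 0) := by
  simpa [sinTransform] using tendsto_integral_mul_tanhIncr hm hδ Real.continuous_sin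
    Real.abs_sin_le_one x k

end TanhIncrement

section Weight

/-- The spectral weight `1 / ((k² + m²) √(k² + 4m²))`. -/
noncomputable def spectralWeight (m k : ℝ) : ℝ := ((k ^ 2 + m ^ 2) * √(k ^ 2 + 4 * m ^ 2))⁻¹

variable {m : ℝ} (hm : 0 < m)
include hm

lemma spectralWeight_pos (k : ℝ) : 0 < spectralWeight m k := by
  rw [spectralWeight]
  positivity

lemma continuous_spectralWeight : Continuous (spectralWeight m) := by
  unfold spectralWeight
  exact Continuous.inv₀ (by fun_prop) fun k => by positivity

omit hm in
lemma two_mul_le_sqrt (k : ℝ) : 2 * m ≤ √(k ^ 2 + 4 * m ^ 2) :=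
  Real.le_sqrt_of_sq_le (by nlinarith [sq_nonneg k])

omit hm in
lemma abs_le_sqrt_add (k : ℝ) : |k| ≤ √(k ^ 2 + 4 * m ^ 2) :=
  Real.abs_le_sqrt (by nlinarith [sq_nonneg m])

lemma mul_spectralWeight (k : ℝ) :
    (k ^ 2 + m ^ 2) * spectralWeight m k = (√(k ^ 2 + 4 * m ^ 2))⁻¹ := by
  have : k ^ 2 + m ^ 2 ≠ 0 := by positivity
  rw [spectralWeight, mul_inv, mul_inv_cancel_left₀ this]

lemma mul_spectralWeight_le (k : ℝ) : (k ^ 2 + m ^ 2) * spectralWeight m k ≤ (2 * m)⁻¹ := by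
  rw [mul_spectralWeight hm]
  exact inv_anti₀ (by positivity) (two_mul_le_sqrt k)

lemma spectralWeight_le (k : ℝ) : spectralWeight m k ≤ (2 * m)⁻¹ * (k ^ 2 + m ^ 2)⁻¹ := by
  rw [← div_eq_mul_inv, le_div_iff₀ (by positivity), mul_comm]
  exact mul_spectralWeight_le hm k

lemma abs_mul_spectralWeight_le (k : ℝ) : |k| * spectralWeight m k ≤ (k ^ 2 + m ^ 2)⁻¹ := by
  have h2 := two_mul_le_sqrt (m := m) k
  rw [spectralWeight, mul_inv, mul_left_comm]
  refine mul_le_of_le_one_right (by positivity) ?_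
  rw [← div_eq_mul_inv, div_le_one (by linarith)]
  exact abs_le_sqrt_add k

lemma integrable_inv_sq_add_sq : Integrable fun k : ℝ => (k ^ 2 + m ^ 2)⁻¹ := by
  refine ((integrable_inv_one_add_sq.comp_div hm.ne').const_mul (m ^ 2)⁻¹).congr
    (.of_forall fun k => ?_)
  field_simp
  ring

lemma integrable_spectralWeight : Integrable (spectralWeight m) :=
  ((integrable_inv_sq_add_sq hm).const_mul (2 * m)⁻¹).mono'
    (continuous_spectralWeight hm).aestronglyMeasurable (.of_forall fun k => by
      rw [Real.norm_of_nonneg (spectralWeight_pos hm k).le]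
      exact spectralWeight_le hm k)

lemma tendsto_div_sqrt_atTop : Tendsto (fun k : ℝ => k / √(k ^ 2 + 4 * m ^ 2)) atTop (𝓝 1) := by
  have h : Tendsto (fun k : ℝ => (√(1 + 4 * m ^ 2 * (k ^ 2)⁻¹))⁻¹) atTop (𝓝 1) := by
    have h0 : Tendsto (fun k : ℝ => (k ^ 2)⁻¹) atTop (𝓝 0) :=
      tendsto_inv_atTop_zero.comp (tendsto_pow_atTop two_ne_zero)
    simpa using ((((h0.const_mul (4 * m ^ 2)).const_add 1).sqrt).inv₀ (by simp))
  refine h.congr' ?_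
  filter_upwards [eventually_gt_atTop 0] with k hk
  rw [show k ^ 2 + 4 * m ^ 2 = k ^ 2 * (1 + 4 * m ^ 2 * (k ^ 2)⁻¹) by field_simp,
    Real.sqrt_mul (sq_nonneg k), Real.sqrt_sq hk.le]
  field_simp

lemma integral_spectralWeight :
    ∫ k, spectralWeight m k = 2 * Real.pi / (3 * √3 * m ^ 2) := by
  have h3 : √3 ^ 2 = 3 := Real.sq_sqrt (by norm_num)
  have hder : ∀ k, HasDerivAt (fun k : ℝ => Real.arctan (√3 * (k / √(k ^ 2 + 4 * m ^ 2))) /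
      (√3 * m ^ 2)) (spectralWeight m k) k := fun k => by
    have hp : 0 < k ^ 2 + 4 * m ^ 2 := by positivity
    have hs : √(k ^ 2 + 4 * m ^ 2) ^ 2 = k ^ 2 + 4 * m ^ 2 := Real.sq_sqrt hp.le
    have hs0 : 0 < √(k ^ 2 + 4 * m ^ 2) := Real.sqrt_pos.mpr hp
    have h1 := (((hasDerivAt_pow 2 k).add_const (4 * m ^ 2)).sqrt hp.ne')
    refine ((((hasDerivAt_id k).div h1 hs0.ne').const_mul √3).arctan.div_const _).congr_deriv ?_
    simp only [Pi.div_apply, id, spectralWeight]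
    set ω := √(k ^ 2 + 4 * m ^ 2)
    have e1 : 1 + (√3 * (k / ω)) ^ 2 = 4 * (k ^ 2 + m ^ 2) / ω ^ 2 := by
      rw [mul_pow, h3]
      field_simp
      linarith
    rw [e1]
    have hk : 0 < k ^ 2 + m ^ 2 := by positivity
    field_simp
    norm_num
    linear_combination 2 * hs
  have htop : Tendsto (fun k : ℝ => Real.arctan (√3 * (k / √(k ^ 2 + 4 * m ^ 2))) /
      (√3 * m ^ 2)) atTop (𝓝 (Real.pi / 3 / (√3 * m ^ 2))) := by
    refine Tendsto.div_const ?_ _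
    rw [← Real.arctan_sqrt_three]
    refine (Real.continuous_arctan.tendsto _).comp ?_
    simpa using (tendsto_div_sqrt_atTop hm).const_mul √3
  have hbot : Tendsto (fun k : ℝ => Real.arctan (√3 * (k / √(k ^ 2 + 4 * m ^ 2))) /
      (√3 * m ^ 2)) atBot (𝓝 (-(Real.pi / 3 / (√3 * m ^ 2)))) := by
    refine (htop.comp tendsto_neg_atBot_atTop).neg.congr fun k => ?_
    simp [neg_div, Real.arctan_neg]
  rw [integral_of_hasDerivAt_of_tendsto hder (integrable_spectralWeight hm) hbot htop]
  field_simp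
  norm_num

end Weight

section Decomposition

/-- The part of the subtracted symbol of the kernel which is linear in the increment of `tanh`
and concentrates at high frequency. -/
noncomputable def linearPart (m : ℝ) (δ1 : ℝ → ℝ) (κ x k : ℝ) : ℝ :=
  (-(6 * m * (2 * m ^ 2 - k ^ 2) * cosTransform δ1 (k / κ) *
      cosTransform (tanhIncr m δ1 κ x) (k / κ)) +
    3 * m ^ 2 * sech (m * x) ^ 2 * cosTransform δ1 (k / κ) ^ 2 * (m ^ 2 - 2 * k ^ 2)) *
    spectralWeight m k

/-- The part of the subtracted symbol of the kernel which converges dominatedly as the cutoff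
is removed. -/
noncomputable def convergentPart (m : ℝ) (δ1 : ℝ → ℝ) (κ x k : ℝ) : ℝ :=
  9 * m ^ 2 * (-(2 * Real.tanh (m * x) * k * cosTransform δ1 (k / κ) *
      sinTransform (tanhIncr m δ1 κ x) (k / κ)) +
    cosTransform (tanhIncr m δ1 κ x) (k / κ) ^ 2 +
    sinTransform (tanhIncr m δ1 κ x) (k / κ) ^ 2) * spectralWeight m k

variable {m : ℝ} {δ1 : ℝ → ℝ} {κ₀ κ : ℝ}

lemma sech_sq_le_exp (hm : 0 < m) (x : ℝ) : sech (m * x) ^ 2 ≤ 2 * Real.exp (-(m * |x|)) := by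
  have h := sech_le_exp (m * x)
  rw [abs_mul, abs_of_pos hm] at h
  nlinarith [sech_le_one (m * x), sech_pos (m * x)]

lemma exists_abs_linearPart_le (hm : 0 < m) (hδ : IsMollifier δ1) (hκ₀ : 0 < κ₀) :
    ∃ C, ∀ κ, κ₀ ≤ κ → ∀ x k, |linearPart m δ1 κ x k| ≤
      C * (Real.exp (-(m * |x|)) * |cosTransform δ1 (k / κ)|) := by
  obtain ⟨P, hP0, hP⟩ := exists_abs_transform_tanhIncr_le hm hδ hκ₀
  obtain ⟨D, hD0, hD⟩ := hδ.exists_abs_cosTransform_le_const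
  refine ⟨(12 * m * P + 12 * m ^ 2 * D) * (2 * m)⁻¹, fun κ hκ x k => ?_⟩
  have hp := (hP κ hκ x (k / κ)).1
  have hd := hD (k / κ)
  have hs := sech_sq_le_exp hm x
  have hw := mul_spectralWeight_le hm k
  rw [linearPart, abs_mul, abs_of_pos (spectralWeight_pos hm k)]
  set c := cosTransform δ1 (k / κ)
  set p := cosTransform (tanhIncr m δ1 κ x) (k / κ)
  set e := Real.exp (-(m * |x|)) with he
  have he0 : 0 < e := Real.exp_pos _
  have ha : |2 * m ^ 2 - k ^ 2| ≤ 2 * (k ^ 2 + m ^ 2) :=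
    abs_le.mpr ⟨by nlinarith, by nlinarith⟩
  have hb : |m ^ 2 - 2 * k ^ 2| ≤ 2 * (k ^ 2 + m ^ 2) :=
    abs_le.mpr ⟨by nlinarith, by nlinarith⟩
  have h1 : |6 * m * (2 * m ^ 2 - k ^ 2) * c * p| ≤
      6 * m * (2 * (k ^ 2 + m ^ 2)) * |c| * (P * e) := by
    rw [abs_mul, abs_mul, abs_mul, abs_of_pos (show 0 < 6 * m by positivity)]
    gcongr
  have h2 : |3 * m ^ 2 * sech (m * x) ^ 2 * c ^ 2 * (m ^ 2 - 2 * k ^ 2)| ≤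
      3 * m ^ 2 * (2 * e) * (D * |c|) * (2 * (k ^ 2 + m ^ 2)) := by
    rw [abs_mul, abs_mul, abs_of_nonneg (show 0 ≤ 3 * m ^ 2 * sech (m * x) ^ 2 by positivity),
      abs_pow, pow_two |c|]
    gcongr
  calc _ ≤ (6 * m * (2 * (k ^ 2 + m ^ 2)) * |c| * (P * e) +
        3 * m ^ 2 * (2 * e) * (D * |c|) * (2 * (k ^ 2 + m ^ 2))) * spectralWeight m k := by
        refine mul_le_mul_of_nonneg_right ((abs_add_le _ _).trans ?_) (spectralWeight_pos hm k).le
        rw [abs_neg]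
        exact add_le_add h1 h2
    _ = (12 * m * P + 12 * m ^ 2 * D) * (e * |c|) * ((k ^ 2 + m ^ 2) * spectralWeight m k) := by
        ring
    _ ≤ (12 * m * P + 12 * m ^ 2 * D) * (e * |c|) * (2 * m)⁻¹ := by gcongr
    _ = _ := by ring

lemma exists_abs_convergentPart_le (hm : 0 < m) (hδ : IsMollifier δ1) (hκ₀ : 0 < κ₀) :
    ∃ C, ∀ κ, κ₀ ≤ κ → ∀ x k, |convergentPart m δ1 κ x k| ≤
      C * (Real.exp (-(m * |x|)) * (k ^ 2 + m ^ 2)⁻¹) := by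
  obtain ⟨P, hP0, hP⟩ := exists_abs_transform_tanhIncr_le hm hδ hκ₀
  obtain ⟨D, hD0, hD⟩ := hδ.exists_abs_cosTransform_le_const
  refine ⟨9 * m ^ 2 * (2 * D * P + 2 * P ^ 2 * (2 * m)⁻¹), fun κ hκ x k => ?_⟩
  obtain ⟨hp, hq⟩ := hP κ hκ x (k / κ)
  have hd := hD (k / κ)
  have hw := spectralWeight_le hm k
  have hkw := abs_mul_spectralWeight_le hm k
  have hw0 := spectralWeight_pos hm k
  have ht : |Real.tanh (m * x)| ≤ 1 := (Real.abs_tanh_lt_one _).le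
  rw [convergentPart, abs_mul, abs_of_pos hw0, abs_mul,
    abs_of_pos (show 0 < 9 * m ^ 2 by positivity)]
  set c := cosTransform δ1 (k / κ)
  set p := cosTransform (tanhIncr m δ1 κ x) (k / κ)
  set q := sinTransform (tanhIncr m δ1 κ x) (k / κ)
  set e := Real.exp (-(m * |x|)) with he
  have he0 : 0 < e := Real.exp_pos _
  have he1 : e ≤ 1 := Real.exp_le_one_iff.mpr (neg_nonpos.mpr (by positivity))
  have hsq : ∀ r : ℝ, |r| ≤ P * e → |r ^ 2| ≤ P ^ 2 * e := fun r hr => by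
    rw [abs_pow]
    calc |r| ^ 2 ≤ (P * e) ^ 2 := by gcongr
      _ = P ^ 2 * (e * e) := by ring
      _ ≤ P ^ 2 * (e * 1) := by gcongr
      _ = _ := by ring
  have h1 : |2 * Real.tanh (m * x) * k * c * q| ≤ 2 * 1 * |k| * D * (P * e) := by
    rw [abs_mul, abs_mul, abs_mul, abs_mul, abs_two]
    gcongr
  calc _ ≤ 9 * m ^ 2 * (2 * 1 * |k| * D * (P * e) + P ^ 2 * e + P ^ 2 * e) *
        spectralWeight m k := by
        gcongr
        refine (abs_add_three _ _ _).trans ?_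
        rw [abs_neg]
        exact add_le_add (add_le_add h1 (hsq _ hp)) (hsq _ hq)
    _ = 9 * m ^ 2 * e * (2 * D * P * (|k| * spectralWeight m k) +
          2 * P ^ 2 * spectralWeight m k) := by ring
    _ ≤ 9 * m ^ 2 * e * (2 * D * P * (k ^ 2 + m ^ 2)⁻¹ +
          2 * P ^ 2 * ((2 * m)⁻¹ * (k ^ 2 + m ^ 2)⁻¹)) := by gcongr
    _ = _ := by ring

lemma measurable_linearPart (hm : 0 < m) (hδ : IsMollifier δ1) :
    Measurable (Function.uncurry (linearPart m δ1 κ)) := by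
  have h1 := measurable_cosTransform_tanhIncr (m := m) (κ := κ) hδ
  have h2 : Measurable fun p : ℝ × ℝ => cosTransform δ1 (p.2 / κ) :=
    hδ.continuous_cosTransform.measurable.comp (by fun_prop)
  have h3 : Measurable fun p : ℝ × ℝ => spectralWeight m p.2 :=
    (continuous_spectralWeight hm).measurable.comp measurable_snd
  have h4 : Measurable fun p : ℝ × ℝ => sech (m * p.1) :=
    continuous_sech.measurable.comp (by fun_prop)
  unfold Function.uncurry linearPart
  fun_prop

lemma measurable_convergentPart (hm : 0 < m) (hδ : IsMollifier δ1) :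
    Measurable (Function.uncurry (convergentPart m δ1 κ)) := by
  have h1 := measurable_cosTransform_tanhIncr (m := m) (κ := κ) hδ
  have h1' := measurable_sinTransform_tanhIncr (m := m) (κ := κ) hδ
  have h2 : Measurable fun p : ℝ × ℝ => cosTransform δ1 (p.2 / κ) :=
    hδ.continuous_cosTransform.measurable.comp (by fun_prop)
  have h3 : Measurable fun p : ℝ × ℝ => spectralWeight m p.2 :=
    (continuous_spectralWeight hm).measurable.comp measurable_snd
  have h4 : Measurable fun p : ℝ × ℝ => Real.tanh (m * p.1) :=
    continuous_tanh.measurable.comp (by fun_prop)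
  unfold Function.uncurry convergentPart
  fun_prop

lemma integrable_linearPart (hm : 0 < m) (hδ : IsMollifier δ1) (hκ : 0 < κ) :
    Integrable (Function.uncurry (linearPart m δ1 κ)) (volume.prod volume) := by
  obtain ⟨C, hC⟩ := exists_abs_linearPart_le hm hδ hκ
  exact (((integrable_exp_neg_mul_abs hm).mul_prod
    (hδ.integrable_cosTransform.comp_div hκ.ne').abs).const_mul C).mono'
    (measurable_linearPart hm hδ).aestronglyMeasurable
    (.of_forall fun p => hC κ le_rfl p.1 p.2)

lemma integrable_convergentPart (hm : 0 < m) (hδ : IsMollifier δ1) (hκ : 0 < κ) :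
    Integrable (Function.uncurry (convergentPart m δ1 κ)) (volume.prod volume) := by
  obtain ⟨C, hC⟩ := exists_abs_convergentPart_le hm hδ hκ
  exact (((integrable_exp_neg_mul_abs hm).mul_prod
    (integrable_inv_sq_add_sq hm)).const_mul C).mono'
    (measurable_convergentPart hm hδ).aestronglyMeasurable
    (.of_forall fun p => hC κ le_rfl p.1 p.2)

lemma integrable_linearPart_apply (hm : 0 < m) (hδ : IsMollifier δ1) (hκ : 0 < κ) (x : ℝ) :
    Integrable (linearPart m δ1 κ x) := by
  obtain ⟨C, hC⟩ := exists_abs_linearPart_le hm hδ hκ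
  exact (((hδ.integrable_cosTransform.comp_div hκ.ne').abs.const_mul _).const_mul C).mono'
    ((measurable_linearPart hm hδ).comp measurable_prodMk_left).aestronglyMeasurable
    (.of_forall (hC κ le_rfl x))

lemma integrable_convergentPart_apply (hm : 0 < m) (hδ : IsMollifier δ1) (hκ : 0 < κ) (x : ℝ) :
    Integrable (convergentPart m δ1 κ x) := by
  obtain ⟨C, hC⟩ := exists_abs_convergentPart_le hm hδ hκ
  exact (((integrable_inv_sq_add_sq hm).const_mul _).const_mul C).mono'
    ((measurable_convergentPart hm hδ).comp measurable_prodMk_left).aestronglyMeasurable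
    (.of_forall (hC κ le_rfl x))

lemma integrable_sqrt_mul_cosTransform_sq (hm : 0 < m) (hδ : IsMollifier δ1) (hκ : 0 < κ) :
    Integrable fun k : ℝ => √(k ^ 2 + 4 * m ^ 2) * cosTransform δ1 (k / κ) ^ 2 := by
  obtain ⟨C, hC0, hC⟩ := hδ.exists_abs_cosTransform_le
  have hc := hδ.continuous_cosTransform
  refine ((hδ.integrable_cosTransform.comp_div hκ.ne').bdd_mul (c := (κ + 2 * m) * C)
    (f := fun k : ℝ => √(k ^ 2 + 4 * m ^ 2) * cosTransform δ1 (k / κ))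
    (by fun_prop) (.of_forall fun k => ?_)).congr (.of_forall fun k => ?_)
  · have h1 : √(k ^ 2 + 4 * m ^ 2) ≤ (κ + 2 * m) * (1 + (k / κ) ^ 2) := by
      refine Real.sqrt_le_iff.mpr ⟨by positivity, ?_⟩
      have hk : k = κ * (k / κ) := by field_simp
      set v := k / κ
      rw [hk]
      nlinarith [mul_pos hκ hm, sq_nonneg v, sq_nonneg (v ^ 2), mul_nonneg (mul_pos hκ hm).le
        (sq_nonneg v), mul_nonneg (sq_nonneg κ) (sq_nonneg (v ^ 2)),
        mul_nonneg (sq_nonneg m) (sq_nonneg (v ^ 2)), mul_nonneg (sq_nonneg m) (sq_nonneg v),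
        mul_nonneg (sq_nonneg κ) (sq_nonneg v), mul_nonneg (mul_pos hκ hm).le
        (sq_nonneg (v ^ 2))]
    rw [norm_mul, Real.norm_of_nonneg (Real.sqrt_nonneg _)]
    calc _ ≤ (κ + 2 * m) * (1 + (k / κ) ^ 2) * (C * (1 + (k / κ) ^ 2)⁻¹) :=
          mul_le_mul h1 (hC _) (abs_nonneg _) (by positivity)
      _ = _ := by
          have : 1 + (k / κ) ^ 2 ≠ 0 := by positivity
          field_simp
  · ring

lemma integrable_cosTransform_sq_div_sqrt (hm : 0 < m) (hδ : IsMollifier δ1) (hκ : 0 < κ) :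
    Integrable fun k : ℝ => cosTransform δ1 (k / κ) ^ 2 / √(k ^ 2 + 4 * m ^ 2) := by
  have hc := hδ.continuous_cosTransform
  refine ((integrable_sqrt_mul_cosTransform_sq hm hδ hκ).const_mul (4 * m ^ 2)⁻¹).mono'
    (Continuous.div (by fun_prop) (by fun_prop) fun k => by positivity).aestronglyMeasurable
    (.of_forall fun k => ?_)
  have hp : 0 < k ^ 2 + 4 * m ^ 2 := by positivity
  rw [Real.norm_of_nonneg (by positivity), div_le_iff₀ (by positivity), ← mul_assoc,
    mul_right_comm, mul_assoc, mul_assoc, ← mul_assoc √_, Real.mul_self_sqrt hp.le, inv_mul_eq_div,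
    le_div_iff₀ (by positivity)]
  nlinarith [sq_nonneg (cosTransform δ1 (k / κ) * k)]

lemma Aker_sub_Bker_add_eq (hm : 0 < m) (hδ : IsMollifier δ1) (hκ : 0 < κ) (x : ℝ) :
    Aker m δ1 κ x - Bker m δ1 κ x + 3 * m ^ 2 * sech (m * x) ^ 2 * Cker m δ1 κ x =
      √3 * m * (∫ u, δ1 u * ψ₁ m (x - u / κ)) ^ 2 +
      1 / (2 * Real.pi) * ((∫ k, linearPart m δ1 κ x k) + ∫ k, convergentPart m δ1 κ x k) := by
  have hψ := integral_moll_smul δ1 hκ (ψ₁ m) x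
  simp only [smul_eq_mul] at hψ
  have iB := integrable_sqrt_mul_cosTransform_sq hm hδ hκ
  have iC := integrable_cosTransform_sq_div_sqrt hm hδ hκ
  have iL := integrable_linearPart_apply hm hδ hκ x
  have iR := integrable_convergentPart_apply hm hδ hκ x
  have hA : ∀ k : ℝ, ‖∫ x' : ℝ, Mker m k x' * Complex.exp (Complex.I * (k : ℂ) * (x' : ℂ)) *
      ((moll δ1 κ (x - x') : ℝ) : ℂ)‖ ^ 2 / ((k ^ 2 + m ^ 2) * √(k ^ 2 + 4 * m ^ 2)) =
      linearPart m δ1 κ x k + convergentPart m δ1 κ x k +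
      √(k ^ 2 + 4 * m ^ 2) * cosTransform δ1 (k / κ) ^ 2 -
      3 * m ^ 2 * sech (m * x) ^ 2 * (cosTransform δ1 (k / κ) ^ 2 / √(k ^ 2 + 4 * m ^ 2)) :=
    fun k => by
    have hp : 0 < k ^ 2 + 4 * m ^ 2 := by positivity
    have hs : √(k ^ 2 + 4 * m ^ 2) ^ 2 = k ^ 2 + 4 * m ^ 2 := Real.sq_sqrt hp.le
    have hs0 : 0 < √(k ^ 2 + 4 * m ^ 2) := Real.sqrt_pos.mpr hp
    have hk : 0 < k ^ 2 + m ^ 2 := by positivity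
    rw [norm_sq_integral_Mker_mul_moll hδ hκ, linearPart, convergentPart, spectralWeight,
      sech_sq_eq]
    generalize √(k ^ 2 + 4 * m ^ 2) = ω at hs hs0 ⊢
    field_simp
    rw [hs]
    ring
  rw [Aker, Bker, Cker, hψ]
  simp_rw [hA, norm_sq_integral_exp_mul_moll_eq hδ hκ]
  have iLR : Integrable fun k => linearPart m δ1 κ x k + convergentPart m δ1 κ x k := iL.add iR
  have iLRB : Integrable fun k => linearPart m δ1 κ x k + convergentPart m δ1 κ x k +
      √(k ^ 2 + 4 * m ^ 2) * cosTransform δ1 (k / κ) ^ 2 := iLR.add iB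
  rw [integral_sub iLRB (iC.const_mul _), integral_add iLR iB, integral_add iL iR,
    integral_const_mul]
  ring

end Decomposition

section CutoffRemoval

variable {m : ℝ} {δ1 : ℝ → ℝ} {κ₀ κ : ℝ}

lemma continuous_ψ₁ : Continuous (ψ₁ m) := by
  unfold ψ₁
  fun_prop

lemma abs_mollifier_mul_ψ₁_le (hm : 0 < m) (hδ : IsMollifier δ1) (hκ₀ : 0 < κ₀) (hκ : κ₀ ≤ κ)
    (x u : ℝ) : |δ1 u * ψ₁ m (x - u / κ)| ≤
      √(3 * m / 2) * (2 * Real.exp (m * κ₀⁻¹) * Real.exp (-(m * |x|))) * |δ1 u| := by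
  have hκ' : 0 < κ := hκ₀.trans_le hκ
  rcases le_or_gt 1 |u| with hu | hu
  · simp [hδ.eq_zero u hu]
  have hw : |u / κ| ≤ κ₀⁻¹ := by
    rw [abs_div, abs_of_pos hκ', ← one_div]
    gcongr
  have hs := sech_mul_sub_le (x := x) hm hw
  have ht := (Real.abs_tanh_lt_one (m * (x - u / κ))).le
  rw [ψ₁, abs_mul, abs_mul, abs_mul, abs_of_nonneg (Real.sqrt_nonneg _),
    abs_of_pos (sech_pos _), mul_comm |δ1 u|]
  refine mul_le_mul_of_nonneg_right ?_ (abs_nonneg _)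
  exact mul_le_mul (mul_le_of_le_one_right (Real.sqrt_nonneg _) ht) hs (sech_pos _).le
    (Real.sqrt_nonneg _)

lemma exists_mollified_ψ₁_sq_le (hm : 0 < m) (hδ : IsMollifier δ1) (hκ₀ : 0 < κ₀) :
    ∃ C, ∀ κ, κ₀ ≤ κ → ∀ x,
      (∫ u, δ1 u * ψ₁ m (x - u / κ)) ^ 2 ≤ C * Real.exp (-(m * |x|)) := by
  set A := √(3 * m / 2) * (2 * Real.exp (m * κ₀⁻¹)) * ∫ u, |δ1 u| with hA
  refine ⟨A ^ 2, fun κ hκ x => ?_⟩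
  have h : |∫ u, δ1 u * ψ₁ m (x - u / κ)| ≤ A * Real.exp (-(m * |x|)) := by
    refine (norm_integral_le_of_norm_le (f := fun u => δ1 u * ψ₁ m (x - u / κ))
      (hδ.integrable.abs.const_mul
        (√(3 * m / 2) * (2 * Real.exp (m * κ₀⁻¹) * Real.exp (-(m * |x|)))))
      (.of_forall fun u => abs_mollifier_mul_ψ₁_le hm hδ hκ₀ hκ x u)).trans ?_
    rw [integral_const_mul, hA]
    exact le_of_eq (by ring)
  have he : Real.exp (-(m * |x|)) ≤ 1 := Real.exp_le_one_iff.mpr (neg_nonpos.mpr (by positivity))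
  rw [← sq_abs]
  calc _ ≤ (A * Real.exp (-(m * |x|))) ^ 2 := by gcongr
    _ = A ^ 2 * (Real.exp (-(m * |x|)) * Real.exp (-(m * |x|))) := by ring
    _ ≤ A ^ 2 * (Real.exp (-(m * |x|)) * 1) := by gcongr
    _ = _ := by ring

lemma measurable_mollified_ψ₁_sq (hδ : IsMollifier δ1) (κ : ℝ) :
    Measurable fun x => (∫ u, δ1 u * ψ₁ m (x - u / κ)) ^ 2 := by
  have hc := hδ.continuous
  have hψ : Continuous (ψ₁ m) := continuous_ψ₁
  have h : Continuous (Function.uncurry fun x u : ℝ => δ1 u * ψ₁ m (x - u / κ)) := by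
    unfold Function.uncurry
    fun_prop
  exact h.stronglyMeasurable.integral_prod_right.measurable.pow_const 2

lemma integrable_mollified_ψ₁_sq (hm : 0 < m) (hδ : IsMollifier δ1) (hκ : 0 < κ) :
    Integrable fun x => (∫ u, δ1 u * ψ₁ m (x - u / κ)) ^ 2 := by
  obtain ⟨C, hC⟩ := exists_mollified_ψ₁_sq_le hm hδ hκ
  refine ((integrable_exp_neg_mul_abs hm).const_mul C).mono'
    (measurable_mollified_ψ₁_sq hδ κ).aestronglyMeasurable (.of_forall fun x => ?_)
  rw [Real.norm_of_nonneg (sq_nonneg _)]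
  exact hC κ le_rfl x

lemma integral_ψ₁_sq (hm : 0 < m) : ∫ x, ψ₁ m x ^ 2 = 1 := by
  have h : ∀ x, ψ₁ m x ^ 2 = 3 * m / 2 * (Real.tanh (m * x) ^ 2 * sech (m * x) ^ 2) := fun x => by
    rw [ψ₁, mul_pow, mul_pow, Real.sq_sqrt (by positivity), mul_assoc]
  simp_rw [h]
  rw [integral_const_mul, integral_tanh_sq_mul_sech_sq hm]
  field_simp

lemma tendsto_mollified_ψ₁ (hm : 0 < m) (hδ : IsMollifier δ1) (x : ℝ) :
    Tendsto (fun κ => ∫ u, δ1 u * ψ₁ m (x - u / κ)) atTop (𝓝 (ψ₁ m x)) := by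
  have hc := hδ.continuous
  have hψ : Continuous (ψ₁ m) := continuous_ψ₁
  have e : ψ₁ m x = ∫ u, δ1 u * ψ₁ m x := by
    rw [integral_mul_const, hδ.integral_eq_one, one_mul]
  rw [e]
  refine tendsto_integral_filter_of_dominated_convergence
    (fun u => √(3 * m / 2) * (2 * Real.exp (m * 1⁻¹) * Real.exp (-(m * |x|))) * |δ1 u|)
    (.of_forall fun κ => by fun_prop) ?_ (hδ.integrable.abs.const_mul _) (.of_forall fun u => ?_)
  · filter_upwards [eventually_ge_atTop 1] with κ hκ
    exact .of_forall fun u => abs_mollifier_mul_ψ₁_le hm hδ one_pos hκ x u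
  · refine ((hψ.tendsto x).comp ?_).const_mul _
    simpa using ((tendsto_const_nhds (x := u)).div_atTop tendsto_id).const_sub x

lemma tendsto_integral_mollified_ψ₁_sq (hm : 0 < m) (hδ : IsMollifier δ1) :
    Tendsto (fun κ => ∫ x, (∫ u, δ1 u * ψ₁ m (x - u / κ)) ^ 2) atTop (𝓝 1) := by
  obtain ⟨C, hC⟩ := exists_mollified_ψ₁_sq_le hm hδ one_pos
  rw [← integral_ψ₁_sq hm]
  refine tendsto_integral_filter_of_dominated_convergence
    (fun x => C * Real.exp (-(m * |x|)))
    (.of_forall fun κ => (measurable_mollified_ψ₁_sq hδ κ).aestronglyMeasurable) ?_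
    ((integrable_exp_neg_mul_abs hm).const_mul C)
    (.of_forall fun x => (tendsto_mollified_ψ₁ hm hδ x).pow 2)
  filter_upwards [eventually_ge_atTop 1] with κ hκ
  refine .of_forall fun x => ?_
  rw [Real.norm_of_nonneg (sq_nonneg _)]
  exact hC κ hκ x

lemma tendsto_const_div_atTop_zero (k : ℝ) : Tendsto (fun κ : ℝ => k / κ) atTop (𝓝 0) :=
  tendsto_const_nhds.div_atTop tendsto_id

lemma tendsto_cosTransform_div_atTop (hδ : IsMollifier δ1) (k : ℝ) :
    Tendsto (fun κ => cosTransform δ1 (k / κ)) atTop (𝓝 1) := by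
  rw [← hδ.cosTransform_zero]
  exact (hδ.continuous_cosTransform.tendsto 0).comp (tendsto_const_div_atTop_zero k)

lemma tendsto_integral_convergentPart (hm : 0 < m) (hδ : IsMollifier δ1) :
    Tendsto (fun κ => ∫ x, ∫ k, convergentPart m δ1 κ x k) atTop
      (𝓝 (12 * m ^ 3 * ∫ k, spectralWeight m k)) := by
  obtain ⟨C, hC⟩ := exists_abs_convergentPart_le hm hδ one_pos
  have e : 12 * m ^ 3 * ∫ k, spectralWeight m k =
      ∫ p : ℝ × ℝ, 9 * m ^ 4 * (sech (m * p.1) ^ 4 * spectralWeight m p.2)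
        ∂(volume.prod volume) := by
    rw [integral_const_mul,
      integral_prod_mul (fun x : ℝ => sech (m * x) ^ 4) (spectralWeight m),
      integral_sech_pow_four hm]
    field_simp
    ring
  rw [e]
  have h : Tendsto (fun κ => ∫ p : ℝ × ℝ, Function.uncurry (convergentPart m δ1 κ) p
      ∂(volume.prod volume)) atTop (𝓝 (∫ p : ℝ × ℝ,
        9 * m ^ 4 * (sech (m * p.1) ^ 4 * spectralWeight m p.2) ∂(volume.prod volume))) := by
    refine tendsto_integral_filter_of_dominated_convergence
      (fun p => C * (Real.exp (-(m * |p.1|)) * (p.2 ^ 2 + m ^ 2)⁻¹))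
      (.of_forall fun κ => (measurable_convergentPart hm hδ).aestronglyMeasurable) ?_
      (((integrable_exp_neg_mul_abs hm).mul_prod (integrable_inv_sq_add_sq hm)).const_mul C)
      (.of_forall fun p => ?_)
    · filter_upwards [eventually_ge_atTop 1] with κ hκ
      exact .of_forall fun p => hC κ hκ p.1 p.2
    · have hc := tendsto_cosTransform_div_atTop hδ p.2
      have hp := tendsto_cosTransform_tanhIncr hm hδ p.1 p.2
      have hq := tendsto_sinTransform_tanhIncr hm hδ p.1 p.2
      have hlim := ((((hc.const_mul (2 * Real.tanh (m * p.1) * p.2)).mul hq).neg.add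
        (hp.pow 2)).add (hq.pow 2)).const_mul (9 * m ^ 2) |>.mul_const (spectralWeight m p.2)
      refine hlim.trans (le_of_eq ?_)
      congr 1
      ring
  refine h.congr' ?_
  filter_upwards [eventually_gt_atTop 0] with κ hκ
  exact integral_prod _ (integrable_convergentPart hm hδ hκ)

/-- The odd multiplier `y (y² - 2m²) / ((y² + m²) √(y² + 4m²))`. -/
noncomputable def oddMultiplier (m y : ℝ) : ℝ := y * (y ^ 2 - 2 * m ^ 2) * spectralWeight m y

lemma continuous_oddMultiplier (hm : 0 < m) : Continuous (oddMultiplier m) := by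
  have := continuous_spectralWeight hm
  unfold oddMultiplier
  fun_prop

lemma abs_oddMultiplier_le (hm : 0 < m) (y : ℝ) : |oddMultiplier m y| ≤ 2 := by
  have hw := spectralWeight_pos hm y
  have hb : |y ^ 2 - 2 * m ^ 2| ≤ 2 * (y ^ 2 + m ^ 2) :=
    abs_le.mpr ⟨by nlinarith, by nlinarith⟩
  rw [oddMultiplier, abs_mul, abs_mul, abs_of_pos hw]
  calc _ ≤ |y| * (2 * (y ^ 2 + m ^ 2)) * spectralWeight m y := by gcongr
    _ = 2 * (y ^ 2 + m ^ 2) * (|y| * spectralWeight m y) := by ring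
    _ ≤ 2 * (y ^ 2 + m ^ 2) * (y ^ 2 + m ^ 2)⁻¹ := by
        gcongr
        exact abs_mul_spectralWeight_le hm y
    _ = 2 := by
        have : y ^ 2 + m ^ 2 ≠ 0 := by positivity
        field_simp

lemma oddMultiplier_neg (y : ℝ) : oddMultiplier m (-y) = -oddMultiplier m y := by
  simp [oddMultiplier, spectralWeight]

lemma tendsto_oddMultiplier_atTop (hm : 0 < m) : Tendsto (oddMultiplier m) atTop (𝓝 1) := by
  have h0 : Tendsto (fun y : ℝ => (y ^ 2 + m ^ 2)⁻¹) atTop (𝓝 0) :=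
    tendsto_inv_atTop_zero.comp
      (tendsto_atTop_add_const_right _ _ (tendsto_pow_atTop two_ne_zero))
  have h := (tendsto_div_sqrt_atTop hm).mul ((h0.const_mul (3 * m ^ 2)).const_sub 1)
  simp only [mul_zero, sub_zero, mul_one] at h
  refine h.congr fun y => ?_
  have hp : 0 < y ^ 2 + 4 * m ^ 2 := by positivity
  have hs0 : 0 < √(y ^ 2 + 4 * m ^ 2) := Real.sqrt_pos.mpr hp
  rw [oddMultiplier, spectralWeight]
  field_simp
  ring

lemma tendsto_oddMultiplier_mul (hm : 0 < m) (v : ℝ) :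
    Tendsto (fun κ => oddMultiplier m (κ * v)) atTop (𝓝 (v / |v|)) := by
  rcases lt_trichotomy v 0 with hv | rfl | hv
  · rw [abs_of_neg hv, div_neg, div_self hv.ne]
    have h := ((tendsto_oddMultiplier_atTop hm).comp
      (tendsto_id.atTop_mul_const (neg_pos.mpr hv))).neg
    refine h.congr fun κ => ?_
    simp [oddMultiplier_neg]
  · simp [oddMultiplier]
  · rw [abs_of_pos hv, div_self hv.ne']
    exact (tendsto_oddMultiplier_atTop hm).comp (tendsto_id.atTop_mul_const hv)

lemma integrable_cosTransform_mul_sinTransform (hδ : IsMollifier δ1) :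
    Integrable fun v => cosTransform δ1 v * sinTransform (fun u => u * δ1 u) v := by
  obtain ⟨C, -, hC⟩ := hδ.exists_abs_sinTransform_id_mul_le
  exact hδ.integrable_cosTransform.mul_bdd (c := C)
    hδ.continuous_sinTransform_id_mul.aestronglyMeasurable (.of_forall hC)

lemma norm_oddMultiplier_mul_le (hm : 0 < m) (y r : ℝ) : ‖oddMultiplier m y * r‖ ≤ 2 * |r| := by
  rw [norm_mul]
  exact mul_le_mul_of_nonneg_right (abs_oddMultiplier_le hm y) (abs_nonneg _)

lemma tendsto_integral_oddMultiplier (hm : 0 < m) (hδ : IsMollifier δ1) :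
    Tendsto (fun κ => ∫ v, oddMultiplier m (κ * v) *
      (cosTransform δ1 v * sinTransform (fun u => u * δ1 u) v)) atTop (𝓝 1) := by
  have h1 := continuous_oddMultiplier hm
  have h2 := hδ.continuous_cosTransform
  have h3 := hδ.continuous_sinTransform_id_mul
  rw [← hδ.integral_sign_mul_cosTransform]
  exact tendsto_integral_filter_of_dominated_convergence
    (fun v => 2 * |cosTransform δ1 v * sinTransform (fun u => u * δ1 u) v|)
    (.of_forall fun κ => by fun_prop)
    (.of_forall fun κ => .of_forall fun v => norm_oddMultiplier_mul_le hm _ _)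
    ((integrable_cosTransform_mul_sinTransform hδ).abs.const_mul 2)
    (.of_forall fun v => (tendsto_oddMultiplier_mul hm v).mul_const _)

lemma norm_cosTransform_sq_mul_spectralWeight_le (hm : 0 < m) {C : ℝ}
    (hC : ∀ v, |cosTransform δ1 v| ≤ C) (v k : ℝ) :
    ‖cosTransform δ1 v ^ 2 * spectralWeight m k‖ ≤ C ^ 2 * spectralWeight m k := by
  rw [norm_mul, norm_pow, Real.norm_of_nonneg (spectralWeight_pos hm k).le]
  have := hC v
  have := spectralWeight_pos hm k
  rw [Real.norm_eq_abs]
  gcongr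

lemma integrable_cosTransform_sq_mul_spectralWeight (hm : 0 < m) (hδ : IsMollifier δ1) (κ : ℝ) :
    Integrable fun k => cosTransform δ1 (k / κ) ^ 2 * spectralWeight m k := by
  obtain ⟨C, -, hC⟩ := hδ.exists_abs_cosTransform_le_const
  have h1 := hδ.continuous_cosTransform
  have h2 := continuous_spectralWeight hm
  exact ((integrable_spectralWeight hm).const_mul (C ^ 2)).mono' (by fun_prop)
    (.of_forall fun k => norm_cosTransform_sq_mul_spectralWeight_le hm hC _ k)

lemma tendsto_integral_cosTransform_sq_mul_spectralWeight (hm : 0 < m) (hδ : IsMollifier δ1) :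
    Tendsto (fun κ => ∫ k, cosTransform δ1 (k / κ) ^ 2 * spectralWeight m k) atTop
      (𝓝 (∫ k, spectralWeight m k)) := by
  obtain ⟨C, -, hC⟩ := hδ.exists_abs_cosTransform_le_const
  refine tendsto_integral_filter_of_dominated_convergence
    (fun k => C ^ 2 * spectralWeight m k)
    (.of_forall fun κ =>
      (integrable_cosTransform_sq_mul_spectralWeight hm hδ κ).aestronglyMeasurable)
    (.of_forall fun κ => .of_forall fun k =>
      norm_cosTransform_sq_mul_spectralWeight_le hm hC _ k)
    ((integrable_spectralWeight hm).const_mul (C ^ 2)) (.of_forall fun k => ?_)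
  simpa using ((tendsto_cosTransform_div_atTop hδ k).pow 2).mul_const (spectralWeight m k)

lemma integral_linearPart_left (hm : 0 < m) (hδ : IsMollifier δ1) (hκ : 0 < κ) (k : ℝ) :
    ∫ x, linearPart m δ1 κ x k =
      -(18 * m ^ 3) * (cosTransform δ1 (k / κ) ^ 2 * spectralWeight m k) -
      12 * m * κ⁻¹ * (oddMultiplier m (κ * (k / κ)) *
        (cosTransform δ1 (k / κ) * sinTransform (fun u => u * δ1 u) (k / κ))) := by
  obtain ⟨C, hC0, hC⟩ := exists_abs_transform_tanhIncr_le hm hδ hκ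
  have hk : κ * (k / κ) = k := by field_simp
  have hi : Integrable fun x => cosTransform (tanhIncr m δ1 κ x) (k / κ) :=
    ((integrable_exp_neg_mul_abs hm).const_mul C).mono'
      ((measurable_cosTransform_tanhIncr hδ).comp measurable_prodMk_right).aestronglyMeasurable
      (.of_forall fun x => (hC κ le_rfl x (k / κ)).1)
  have e : ∀ x, linearPart m δ1 κ x k =
      -(6 * m * (2 * m ^ 2 - k ^ 2) * cosTransform δ1 (k / κ) * spectralWeight m k) *
        cosTransform (tanhIncr m δ1 κ x) (k / κ) +
      (3 * m ^ 2 * cosTransform δ1 (k / κ) ^ 2 * (m ^ 2 - 2 * k ^ 2) * spectralWeight m k) *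
        sech (m * x) ^ 2 := fun x => by
    rw [linearPart]
    ring
  simp_rw [e]
  rw [integral_add (hi.const_mul _) ((integrable_sech_sq hm).const_mul _), integral_const_mul,
    integral_const_mul, integral_cosTransform_tanhIncr hm hδ hκ, integral_sech_sq hm,
    hδ.cosTransform_id_mul_deriv, hk, oddMultiplier]
  field_simp
  ring

lemma integral_linearPart (hm : 0 < m) (hδ : IsMollifier δ1) (hκ : 0 < κ) :
    ∫ x, ∫ k, linearPart m δ1 κ x k =
      -(18 * m ^ 3) * (∫ k, cosTransform δ1 (k / κ) ^ 2 * spectralWeight m k) -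
      12 * m * ∫ v, oddMultiplier m (κ * v) *
        (cosTransform δ1 v * sinTransform (fun u => u * δ1 u) v) := by
  have h1 := continuous_oddMultiplier hm
  have hi : Integrable fun v => oddMultiplier m (κ * v) *
      (cosTransform δ1 v * sinTransform (fun u => u * δ1 u) v) :=
    (integrable_cosTransform_mul_sinTransform hδ).bdd_mul (c := 2) (by fun_prop)
      (.of_forall fun v => abs_oddMultiplier_le hm _)
  have hi' := hi.comp_div hκ.ne'
  have hs := Measure.integral_comp_div (fun v => oddMultiplier m (κ * v) *
      (cosTransform δ1 v * sinTransform (fun u => u * δ1 u) v)) κ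
  rw [integral_integral_swap (integrable_linearPart hm hδ hκ)]
  simp_rw [integral_linearPart_left hm hδ hκ]
  rw [integral_sub
    ((integrable_cosTransform_sq_mul_spectralWeight hm hδ κ).const_mul _) (hi'.const_mul _),
    integral_const_mul, integral_const_mul, hs, abs_of_pos hκ, smul_eq_mul]
  field_simp

lemma tendsto_integral_linearPart (hm : 0 < m) (hδ : IsMollifier δ1) :
    Tendsto (fun κ => ∫ x, ∫ k, linearPart m δ1 κ x k) atTop
      (𝓝 (-(18 * m ^ 3) * (∫ k, spectralWeight m k) - 12 * m)) := by
  have h := ((tendsto_integral_cosTransform_sq_mul_spectralWeight hm hδ).const_mul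
    (-(18 * m ^ 3))).sub ((tendsto_integral_oddMultiplier hm hδ).const_mul (12 * m))
  rw [mul_one] at h
  refine h.congr' ?_
  filter_upwards [eventually_gt_atTop 0] with κ hκ
  exact (integral_linearPart hm hδ hκ).symm

lemma integrable_integral_linearPart (hm : 0 < m) (hδ : IsMollifier δ1) (hκ : 0 < κ) :
    Integrable fun x => ∫ k, linearPart m δ1 κ x k :=
  (integrable_linearPart hm hδ hκ).integral_prod_left

lemma integrable_integral_convergentPart (hm : 0 < m) (hδ : IsMollifier δ1) (hκ : 0 < κ) :
    Integrable fun x => ∫ k, convergentPart m δ1 κ x k :=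
  (integrable_convergentPart hm hδ hκ).integral_prod_left

lemma integral_Aker_sub_Bker_add (hm : 0 < m) (hδ : IsMollifier δ1) (hκ : 0 < κ) :
    ∫ x, (Aker m δ1 κ x - Bker m δ1 κ x + 3 * m ^ 2 * sech (m * x) ^ 2 * Cker m δ1 κ x) =
      √3 * m * (∫ x, (∫ u, δ1 u * ψ₁ m (x - u / κ)) ^ 2) +
      1 / (2 * Real.pi) * ((∫ x, ∫ k, linearPart m δ1 κ x k) +
        ∫ x, ∫ k, convergentPart m δ1 κ x k) := by
  simp_rw [Aker_sub_Bker_add_eq hm hδ hκ]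
  have iL := integrable_integral_linearPart hm hδ hκ
  have iR := integrable_integral_convergentPart hm hδ hκ
  have iLR : Integrable fun x =>
      (∫ k, linearPart m δ1 κ x k) + ∫ k, convergentPart m δ1 κ x k := iL.add iR
  rw [integral_add ((integrable_mollified_ψ₁_sq hm hδ hκ).const_mul _)
    (iLR.const_mul _), integral_const_mul, integral_const_mul, integral_add iL iR]

end CutoffRemoval

/-- Dashen–Hasslacher–Neveu semiclassical mass shift: for each `κ > 0` the function
`x ↦ K^{1/2}_κ(x,x) − K₀^{1/2}_κ(x,x) + 3m²·sech²(m x)·C₀^{1/2}_κ(x,x)` is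
integrable on `ℝ`, and as `κ → +∞` the quantity
`(1/2)·∫ (K^{1/2}_κ(x,x) − K₀^{1/2}_κ(x,x) + 3m²·sech²(m x)·C₀^{1/2}_κ(x,x)) dx`
converges to `m/(2√3) − 3m/π = −m·(3/π − 1/(2√3))`. -/
theorem dhn_mass_shift (m : ℝ) (hm : 0 < m) (δ1 : ℝ → ℝ)
    (hsmooth : ContDiff ℝ (⊤ : ℕ∞) δ1) (hnonneg : ∀ x, 0 ≤ δ1 x)
    (heven : ∀ x, δ1 (-x) = δ1 x) (hsupp : ∀ x, 1 ≤ |x| → δ1 x = 0)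
    (hone : ∫ x : ℝ, δ1 x = 1) :
    (∀ κ : ℝ, 0 < κ → Integrable (fun x : ℝ =>
      Aker m δ1 κ x - Bker m δ1 κ x + 3 * m ^ 2 * (sech (m * x)) ^ 2 * Cker m δ1 κ x)) ∧
    Tendsto (fun κ : ℝ => (1 / 2) *
        ∫ x : ℝ, (Aker m δ1 κ x - Bker m δ1 κ x
          + 3 * m ^ 2 * (sech (m * x)) ^ 2 * Cker m δ1 κ x))
      atTop (nhds (m / (2 * Real.sqrt 3) - 3 * m / Real.pi)) := by
  have hδ : IsMollifier δ1 := ⟨hsmooth, heven, hsupp, hone⟩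
  refine ⟨fun κ hκ => ?_, ?_⟩
  · simp_rw [Aker_sub_Bker_add_eq hm hδ hκ]
    exact ((integrable_mollified_ψ₁_sq hm hδ hκ).const_mul _).add
      (((integrable_integral_linearPart hm hδ hκ).add
        (integrable_integral_convergentPart hm hδ hκ)).const_mul _)
  · have h := (((tendsto_integral_mollified_ψ₁_sq hm hδ).const_mul (√3 * m)).add
      (((tendsto_integral_linearPart hm hδ).add (tendsto_integral_convergentPart hm hδ)).const_mul
        (1 / (2 * Real.pi)))).const_mul (1 / 2)
    refine (h.congr' ?_).trans (le_of_eq ?_)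
    · filter_upwards [eventually_gt_atTop 0] with κ hκ
      rw [integral_Aker_sub_Bker_add hm hδ hκ]
    · congr 1
      have h3 : √3 ^ 2 = 3 := Real.sq_sqrt (by norm_num)
      rw [integral_spectralWeight hm]
      have hπ := Real.pi_pos
      field_simp
      linear_combination 6 * Real.pi * h3
end
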